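/- Let n ≥ 2 and p ≥ 1. Then for every nonzero nonnegative continuous function f : ℝⁿ → ℝ with compact support, ‖f‖₁^{n+p} ≤ 2^{−n} n^{p} R_{n,p}^{p} ‖f‖_∞^{p} ( ∫_{S^{n−1}} ( ∫_{ℝⁿ} f(x) |⟨x,ξ⟩|^p dx )^{−n/p} dξ )^{−p}, where ‖f‖_∞ = sup_{x∈ℝⁿ} f(x). Moreover, equality holds if and only if f = a·χ_{B^{-1}(B₂ⁿ)} for some a > 0 and some invertible n×n matrix B, i.e. f is a positive multiple of the characteristic function of an origin-centered ellipsoid. -/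

import Mathlib

open MeasureTheory Real
open scoped RealInnerProductSpace

/-- The constant `R_{n,p}` from the Haberl–Schuster asymmetric `L_p` Blaschke–Santaló
inequality: the value of the sharp bound, attained for the Euclidean ball. -/
noncomputable def Rnp (n : ℕ) (p : ℝ) : ℝ :=
  Real.pi ^ ((n : ℝ) / (2 * p) + n) / (Real.Gamma (((n : ℝ) + 2) / 2)) ^ (2 : ℕ) *
    (2 * Real.Gamma (((n : ℝ) + p + 2) / 2) /
      (Real.Gamma (((n : ℝ) + 2) / 2) * Real.Gamma ((p + 1) / 2))) ^ ((n : ℝ) / p)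

/-- Application of an `n × n` real matrix to a point of `EuclideanSpace ℝ (Fin n)`. -/
noncomputable def matApply {n : ℕ} (B : Matrix (Fin n) (Fin n) ℝ)
    (x : EuclideanSpace ℝ (Fin n)) : EuclideanSpace ℝ (Fin n) :=
  (EuclideanSpace.equiv (Fin n) ℝ).symm (B.mulVec (EuclideanSpace.equiv (Fin n) ℝ x))

namespace LpSantalo

open Set
open scoped ENNReal Pointwise

/-- Insert the value `s` as the `i`-th coordinate. -/
def ins {n : ℕ} (i : Fin (n + 1)) (s : ℝ) (x : Fin n → ℝ) : Fin (n + 1) → ℝ :=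
  i.insertNth (α := fun _ => ℝ) s x

section ins

variable {n : ℕ} (i : Fin (n + 1))

@[simp] lemma ins_same (s : ℝ) (x : Fin n → ℝ) : ins i s x i = s := by simp [ins]

@[simp] lemma ins_succAbove (s : ℝ) (x : Fin n → ℝ) (j : Fin n) :
    ins i s x (i.succAbove j) = x j := by simp [ins]

lemma ins_removeNth (x : Fin (n + 1) → ℝ) : ins i (x i) (i.removeNth x) = x := by
  simp [ins]

@[simp] lemma removeNth_ins (s : ℝ) (x : Fin n → ℝ) : i.removeNth (ins i s x) = x := by
  ext j; simp [Fin.removeNth]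

lemma continuous_ins : Continuous fun q : ℝ × (Fin n → ℝ) => ins i q.1 q.2 :=
  Continuous.finInsertNth i continuous_fst continuous_snd

lemma measurable_ins : Measurable fun q : ℝ × (Fin n → ℝ) => ins i q.1 q.2 :=
  (continuous_ins i).measurable

lemma ins_dotProduct (s t : ℝ) (x y : Fin n → ℝ) :
    ins i s x ⬝ᵥ ins i t y = s * t + x ⬝ᵥ y := by
  simp [dotProduct, Fin.sum_univ_succAbove _ i]

lemma measurePreserving_ins :
    MeasurePreserving (fun q : ℝ × (Fin n → ℝ) => ins i q.1 q.2) :=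
  (volume_preserving_piFinSuccAbove (fun _ : Fin (n + 1) => ℝ) i).symm

lemma lintegral_ins {F : (Fin (n + 1) → ℝ) → ℝ≥0∞} (hF : Measurable F) :
    ∫⁻ x, F x = ∫⁻ s, ∫⁻ x, F (ins i s x) := by
  rw [← (measurePreserving_ins i).lintegral_comp hF]
  exact lintegral_prod _ (hF.comp (measurable_ins i)).aemeasurable

lemma lintegral_ins' {F : (Fin (n + 1) → ℝ) → ℝ≥0∞} (hF : Measurable F) :
    ∫⁻ x, F x = ∫⁻ x, ∫⁻ s, F (ins i s x) := by
  rw [← (measurePreserving_ins i).lintegral_comp hF]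
  exact lintegral_prod_symm _ (hF.comp (measurable_ins i)).aemeasurable

end ins

section PrekopaLeindler

lemma volume_add_volume_le_of_isCompact {A B S : Set ℝ} (hA : IsCompact A) (hB : IsCompact B)
    (hA' : A.Nonempty) (hB' : B.Nonempty) (h : ∀ a ∈ A, ∀ b ∈ B, (a + b) / 2 ∈ S) :
    volume A + volume B ≤ 2 * volume S := by
  obtain ⟨a, ha, ha'⟩ := hA.exists_isGreatest hA'
  obtain ⟨b, hb, hb'⟩ := hB.exists_isLeast hB'
  have e1 : volume ((fun x => (2 : ℝ)⁻¹ * (x + b)) '' A) = 2⁻¹ * volume A := by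
    have : (fun x => (2 : ℝ)⁻¹ * (x + b)) '' A = (2 : ℝ)⁻¹ • ((fun x => x + b) '' A) := by
      rw [← image_smul, image_image]; rfl
    rw [this, Measure.addHaar_smul]
    simp
  have e2 : volume ((fun x => (2 : ℝ)⁻¹ * (a + x)) '' B) = 2⁻¹ * volume B := by
    have : (fun x => (2 : ℝ)⁻¹ * (a + x)) '' B = (2 : ℝ)⁻¹ • ((fun x => a + x) '' B) := by
      rw [← image_smul, image_image]; rfl
    rw [this, Measure.addHaar_smul]
    simp
  have hd : AEDisjoint volume ((fun x => (2 : ℝ)⁻¹ * (x + b)) '' A)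
      ((fun x => (2 : ℝ)⁻¹ * (a + x)) '' B) := by
    refine measure_mono_null (t := {(2 : ℝ)⁻¹ * (a + b)}) ?_ (by simp)
    rintro _ ⟨⟨x, hx, rfl⟩, ⟨y, hy, hxy⟩⟩
    have h1 := ha' hx
    have h2 := hb' hy
    simp only [mem_singleton_iff] at *
    linarith
  have hm : MeasurableSet ((fun x => (2 : ℝ)⁻¹ * (a + x)) '' B) :=
    (hB.image (by fun_prop)).measurableSet
  have hu : ((fun x => (2 : ℝ)⁻¹ * (x + b)) '' A) ∪ ((fun x => (2 : ℝ)⁻¹ * (a + x)) '' B) ⊆ S := by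
    rintro _ (⟨x, hx, rfl⟩ | ⟨x, hx, rfl⟩)
    · have := h x hx b hb
      rwa [div_eq_inv_mul] at this
    · have := h a ha x hx
      rwa [div_eq_inv_mul] at this
  have := measure_mono (μ := volume) hu
  rw [measure_union₀ hm.nullMeasurableSet hd, e1, e2, ← mul_add] at this
  calc volume A + volume B = 2 * (2⁻¹ * (volume A + volume B)) := by
        rw [← mul_assoc, ENNReal.mul_inv_cancel (by simp) (by simp), one_mul]
    _ ≤ _ := by gcongr

lemma volume_add_volume_le {A B S : Set ℝ} (hA : MeasurableSet A) (hB : MeasurableSet B)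
    (hA' : A.Nonempty) (hB' : B.Nonempty) (h : ∀ a ∈ A, ∀ b ∈ B, (a + b) / 2 ∈ S) :
    volume A + volume B ≤ 2 * volume S := by
  have key : ∀ K ⊆ A, IsCompact K → ∀ K' ⊆ B, IsCompact K' →
      volume K + volume K' ≤ 2 * volume S := by
    intro K hKA hK K' hKB hK'
    obtain ⟨a, ha⟩ := hA'
    obtain ⟨b, hb⟩ := hB'
    have := volume_add_volume_le_of_isCompact (S := S) (hK.insert a) (hK'.insert b)
      (insert_nonempty _ _) (insert_nonempty _ _)
      (fun x hx y hy => h x (insert_subset ha hKA hx) y (insert_subset hb hKB hy))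
    refine le_trans ?_ this
    gcongr <;> exact subset_insert _ _
  rw [hA.measure_eq_iSup_isCompact, hB.measure_eq_iSup_isCompact]
  simp only [iSup_and']
  exact ENNReal.biSup_add_biSup_le' ⟨∅, by simp⟩ ⟨∅, by simp⟩
    fun K hK K' hK' => key K hK.1 hK.2 K' hK'.1 hK'.2

lemma lintegral_add_le_of_superlevel {f g h : ℝ → ℝ} (hf : Measurable f) (hg : Measurable g)
    (hh : Measurable h) (hf0 : ∀ x, 0 ≤ f x) (hg0 : ∀ x, 0 ≤ g x) (hh0 : ∀ x, 0 ≤ h x)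
    (hf1 : ∀ x, f x ≤ 1) (hg1 : ∀ x, g x ≤ 1)
    (hf2 : ∀ t < 1, ∃ x, t < f x) (hg2 : ∀ t < 1, ∃ x, t < g x)
    (H : ∀ x y, f x * g y ≤ h ((x + y) / 2) ^ 2) :
    (∫⁻ x, ENNReal.ofReal (f x)) + ∫⁻ x, ENNReal.ofReal (g x) ≤
      2 * ∫⁻ x, ENNReal.ofReal (h x) := by
  rw [lintegral_eq_lintegral_meas_lt _ (.of_forall hf0) hf.aemeasurable,
    lintegral_eq_lintegral_meas_lt _ (.of_forall hg0) hg.aemeasurable,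
    lintegral_eq_lintegral_meas_lt _ (.of_forall hh0) hh.aemeasurable,
    ← lintegral_const_mul' _ _ (by simp)]
  refine (le_lintegral_add _ _).trans (setLIntegral_mono' measurableSet_Ioi fun t ht => ?_)
  rcases lt_or_ge t 1 with h1 | h1
  · refine volume_add_volume_le (measurableSet_lt measurable_const hf)
      (measurableSet_lt measurable_const hg) (hf2 t h1) (hg2 t h1) fun a ha b hb => ?_
    have ht0 : 0 < t := ht
    simp only [mem_ofPred_eq] at *
    refine lt_of_pow_lt_pow_left₀ 2 (hh0 _) (lt_of_lt_of_le ?_ (H a b))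
    nlinarith
  · have e1 : {a | t < f a} = ∅ := by
      ext x; simpa using (hf1 x).trans h1
    have e2 : {a | t < g a} = ∅ := by
      ext x; simpa using (hg1 x).trans h1
    simp [e1, e2]

lemma mul_le_sq_of_add_le_two_mul {X Y V : ℝ≥0∞} (key : X + Y ≤ 2 * V) : X * Y ≤ V ^ 2 := by
  rcases eq_or_ne V ∞ with hV | hV
  · simp [hV]
  have hX : X ≠ ∞ := ne_top_of_le_ne_top (by finiteness) (le_self_add.trans key)
  have hY : Y ≠ ∞ := ne_top_of_le_ne_top (by finiteness) (le_add_self.trans key)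
  lift X to NNReal using hX
  lift Y to NNReal using hY
  lift V to NNReal using hV
  norm_cast at key ⊢
  rw [← NNReal.coe_le_coe] at key ⊢
  push_cast at key ⊢
  nlinarith [sq_nonneg ((X : ℝ) - Y), X.2, Y.2, V.2]

lemma prekopaLeindler_one_of_bdd {f g h : ℝ → ℝ≥0∞} (hf : Measurable f) (hg : Measurable g)
    (hh : Measurable h) {N : ℝ≥0∞} (hN : N ≠ ∞) (hfN : ∀ x, f x ≤ N) (hgN : ∀ x, g x ≤ N)
    (H : ∀ x y, f x * g y ≤ h ((x + y) / 2) ^ 2) :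
    (∫⁻ x, f x) * ∫⁻ x, g x ≤ (∫⁻ x, h x) ^ 2 := by
  set a := ⨆ x, f x with ha
  set b := ⨆ x, g x with hb
  have hfa : ∀ x, f x ≤ a := le_iSup f
  have hgb : ∀ x, g x ≤ b := le_iSup g
  have hat : a ≠ ∞ := ((iSup_le hfN).trans_lt hN.lt_top).ne
  have hbt : b ≠ ∞ := ((iSup_le hgN).trans_lt hN.lt_top).ne
  rcases eq_or_ne a 0 with h0 | h0
  · have : ∀ x, f x = 0 := fun x => le_antisymm (h0 ▸ hfa x) bot_le
    simp [this]
  rcases eq_or_ne b 0 with h0' | h0'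
  · have : ∀ x, g x = 0 := fun x => le_antisymm (h0' ▸ hgb x) bot_le
    simp [this]
  have ha0 : 0 < a.toReal := ENNReal.toReal_pos h0 hat
  have hb0 : 0 < b.toReal := ENNReal.toReal_pos h0' hbt
  set c : ℝ := √(a.toReal * b.toReal) with hc
  have hc0 : 0 < c := Real.sqrt_pos.2 (by positivity)
  have hcc : c ^ 2 = a.toReal * b.toReal := Real.sq_sqrt (by positivity)
  have hft : ∀ x, f x ≠ ∞ := fun x => ((hfa x).trans_lt hat.lt_top).ne
  have hgt : ∀ x, g x ≠ ∞ := fun x => ((hgb x).trans_lt hbt.lt_top).ne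
  have hmin : ∀ x, min (h x) (ENNReal.ofReal c) ≠ ∞ :=
    fun x => ((min_le_right _ _).trans_lt ENNReal.ofReal_lt_top).ne
  have key := lintegral_add_le_of_superlevel (f := fun x => (f x).toReal / a.toReal)
    (g := fun x => (g x).toReal / b.toReal)
    (h := fun x => (min (h x) (ENNReal.ofReal c)).toReal / c)
    (hf.ennreal_toReal.div_const _) (hg.ennreal_toReal.div_const _)
    ((hh.min measurable_const).ennreal_toReal.div_const _)
    (fun x => by positivity) (fun x => by positivity) (fun x => by positivity)
    (fun x => (div_le_one ha0).2 (ENNReal.toReal_mono hat (hfa x)))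
    (fun x => (div_le_one hb0).2 (ENNReal.toReal_mono hbt (hgb x))) ?_ ?_ ?_
  · have e : ∀ (F : ℝ → ℝ≥0∞) (r : ℝ) (hF : ∀ x, F x ≠ ∞) (hr : 0 < r),
        ∫⁻ x, ENNReal.ofReal ((F x).toReal / r) = (∫⁻ x, F x) / ENNReal.ofReal r := by
      intro F r hF hr
      rw [div_eq_mul_inv, ← lintegral_mul_const' _ _ (by simp [hr])]
      refine lintegral_congr fun x => ?_
      rw [ENNReal.ofReal_div_of_pos hr, ENNReal.ofReal_toReal (hF x), div_eq_mul_inv]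
    rw [e f _ hft ha0, e g _ hgt hb0, e _ c hmin hc0, ENNReal.ofReal_toReal hat,
      ENNReal.ofReal_toReal hbt] at key
    set X := (∫⁻ x, f x) / a
    set Y := (∫⁻ x, g x) / b
    set W := ∫⁻ x, min (h x) (ENNReal.ofReal c)
    have hXY : X * Y ≤ (W / ENNReal.ofReal c) ^ 2 := mul_le_sq_of_add_le_two_mul key
    have hWle : W ≤ ∫⁻ x, h x := lintegral_mono fun x => min_le_left _ _
    calc (∫⁻ x, f x) * ∫⁻ x, g x = (a * X) * (b * Y) := by
          rw [ENNReal.mul_div_cancel h0 hat, ENNReal.mul_div_cancel h0' hbt]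
      _ = (a * b) * (X * Y) := by ring
      _ ≤ (ENNReal.ofReal c) ^ 2 * (W / ENNReal.ofReal c) ^ 2 := by
          gcongr
          rw [← ENNReal.ofReal_pow hc0.le, hcc, ENNReal.ofReal_mul ha0.le,
            ENNReal.ofReal_toReal hat, ENNReal.ofReal_toReal hbt]
      _ = W ^ 2 := by
          rw [← mul_pow, ENNReal.mul_div_cancel (by simp [hc0]) (by simp)]
      _ ≤ _ := by gcongr
  · intro t ht
    have : ENNReal.ofReal (t * a.toReal) < a :=
      calc _ < ENNReal.ofReal a.toReal := (ENNReal.ofReal_lt_ofReal_iff ha0).2 (by nlinarith)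
        _ = a := ENNReal.ofReal_toReal hat
    obtain ⟨x, hx⟩ := lt_iSup_iff.1 this
    refine ⟨x, ?_⟩
    rw [lt_div_iff₀ ha0]
    by_contra! hcon
    exact absurd (ENNReal.ofReal_le_ofReal hcon)
      (by rw [ENNReal.ofReal_toReal (hft x)]; simpa using hx)
  · intro t ht
    have : ENNReal.ofReal (t * b.toReal) < b :=
      calc _ < ENNReal.ofReal b.toReal := (ENNReal.ofReal_lt_ofReal_iff hb0).2 (by nlinarith)
        _ = b := ENNReal.ofReal_toReal hbt
    obtain ⟨x, hx⟩ := lt_iSup_iff.1 this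
    refine ⟨x, ?_⟩
    rw [lt_div_iff₀ hb0]
    by_contra! hcon
    exact absurd (ENNReal.ofReal_le_ofReal hcon)
      (by rw [ENNReal.ofReal_toReal (hgt x)]; simpa using hx)
  · intro x y
    have h1 : f x * g y ≤ (min (h ((x + y) / 2)) (ENNReal.ofReal c)) ^ 2 := by
      rcases min_choice (h ((x + y) / 2)) (ENNReal.ofReal c) with hm | hm <;> rw [hm]
      · exact H x y
      · rw [← ENNReal.ofReal_pow hc0.le, hcc, ENNReal.ofReal_mul ha0.le,
            ENNReal.ofReal_toReal hat, ENNReal.ofReal_toReal hbt]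
        gcongr
        · exact hfa x
        · exact hgb y
    have h2 := ENNReal.toReal_mono (ENNReal.pow_ne_top (hmin _)) h1
    rw [ENNReal.toReal_mul, ENNReal.toReal_pow] at h2
    rw [div_mul_div_comm, div_pow, hcc]
    gcongr

lemma prekopaLeindler_one {f g h : ℝ → ℝ≥0∞} (hf : Measurable f) (hg : Measurable g)
    (hh : Measurable h) (H : ∀ x y, f x * g y ≤ h ((x + y) / 2) ^ 2) :
    (∫⁻ x, f x) * ∫⁻ x, g x ≤ (∫⁻ x, h x) ^ 2 := by
  have lim : ∀ {F : ℝ → ℝ≥0∞}, Measurable F →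
      Filter.Tendsto (fun N : ℕ => ∫⁻ x, min (F x) N) Filter.atTop (nhds (∫⁻ x, F x)) := by
    intro F hF
    refine lintegral_tendsto_of_tendsto_of_monotone
      (fun N => (hF.min measurable_const).aemeasurable)
      (.of_forall fun x i j hij => min_le_min_left _ (by exact_mod_cast hij))
      (.of_forall fun x => ?_)
    have := (tendsto_const_nhds (x := F x)).min ENNReal.tendsto_nat_nhds_top
    simpa using this
  have key : ∀ N : ℕ, (∫⁻ x, min (f x) N) * ∫⁻ x, min (g x) N ≤ (∫⁻ x, h x) ^ 2 := fun N =>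
    prekopaLeindler_one_of_bdd (hf.min measurable_const) (hg.min measurable_const) hh
      (ENNReal.natCast_ne_top N) (fun x => min_le_right _ _) (fun x => min_le_right _ _)
      fun x y => le_trans (by gcongr <;> exact min_le_left _ _) (H x y)
  rcases eq_or_ne (∫⁻ x, f x) 0 with h0 | h0
  · simp [h0]
  rcases eq_or_ne (∫⁻ x, g x) 0 with h0' | h0'
  · simp [h0']
  exact le_of_tendsto (ENNReal.Tendsto.mul (lim hf) (.inl h0) (lim hg) (.inl h0'))
    (.of_forall key)

/-- The Prékopa–Leindler inequality for midpoints. -/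
theorem prekopaLeindler {n : ℕ} : ∀ {f g h : (Fin n → ℝ) → ℝ≥0∞}, Measurable f → Measurable g →
    Measurable h → (∀ x y, f x * g y ≤ h ((2 : ℝ)⁻¹ • (x + y)) ^ 2) →
    (∫⁻ x, f x) * ∫⁻ x, g x ≤ (∫⁻ x, h x) ^ 2 := by
  induction n with
  | zero =>
    intro f g h hf hg hh H
    have := H default default
    simp only [Measure.volume_pi_eq_dirac (default : Fin 0 → ℝ), lintegral_dirac]
    convert this
  | succ n ih =>
    intro f g h hf hg hh H
    have hm : ∀ {F : (Fin (n + 1) → ℝ) → ℝ≥0∞}, Measurable F →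
        Measurable fun s => ∫⁻ x, F (ins 0 s x) := fun hF =>
      (hF.comp (measurable_ins 0)).lintegral_prod_right'
    have hm' : ∀ {F : (Fin (n + 1) → ℝ) → ℝ≥0∞}, Measurable F → ∀ s,
        Measurable fun x => F (ins 0 s x) := fun hF s =>
      hF.comp ((measurable_ins 0).comp measurable_prodMk_left)
    rw [lintegral_ins 0 hf, lintegral_ins 0 hg, lintegral_ins 0 hh]
    refine prekopaLeindler_one (hm hf) (hm hg) (hm hh) fun s t => ?_
    refine ih (hm' hf s) (hm' hg t) (hm' hh _) fun x y => (H _ _).trans_eq ?_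
    congr 2
    ext j
    refine Fin.succAboveCases 0 ?_ (fun k => ?_) j
    · simp; ring
    · simp only [Pi.smul_apply, Pi.add_apply, ins_succAbove, smul_eq_mul]

end PrekopaLeindler

section Steiner

lemma abs_rpow_convex {p : ℝ} (hp : 1 ≤ p) {a b x y : ℝ} (ha : 0 ≤ a) (hb : 0 ≤ b)
    (hab : a + b = 1) : |a * x + b * y| ^ p ≤ a * |x| ^ p + b * |y| ^ p := by
  have h1 := (convexOn_rpow hp).2 (abs_nonneg x) (abs_nonneg y) ha hb hab
  simp only [smul_eq_mul] at h1
  refine le_trans (rpow_le_rpow (abs_nonneg _) ?_ (by linarith)) h1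
  refine (abs_add_le _ _).trans_eq ?_
  rw [abs_mul, abs_mul, abs_of_nonneg ha, abs_of_nonneg hb]

lemma abs_rpow_add_le_of_abs_le {p : ℝ} (hp : 1 ≤ p) (e t : ℝ) {σ τ : ℝ} (h : |σ| ≤ |τ|) :
    |e + t * σ| ^ p + |e - t * σ| ^ p ≤ |e + t * τ| ^ p + |e - t * τ| ^ p := by
  rcases eq_or_ne τ 0 with rfl | hτ
  · have : σ = 0 := by simpa using h
    simp [this]
  obtain ⟨r, rfl, hr⟩ : ∃ r, σ = r * τ ∧ |r| ≤ 1 := by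
    refine ⟨σ / τ, by field_simp, ?_⟩
    rw [abs_div, div_le_one (abs_pos.2 hτ)]
    exact h
  have hr' := abs_le.1 hr
  have h1 := abs_rpow_convex hp (a := (1 + r) / 2) (b := (1 - r) / 2) (x := e + t * τ)
    (y := e - t * τ) (by linarith) (by linarith) (by ring)
  have h2 := abs_rpow_convex hp (a := (1 - r) / 2) (b := (1 + r) / 2) (x := e + t * τ)
    (y := e - t * τ) (by linarith) (by linarith) (by ring)
  have e1 : (1 + r) / 2 * (e + t * τ) + (1 - r) / 2 * (e - t * τ) = e + t * (r * τ) := by ring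
  have e2 : (1 - r) / 2 * (e + t * τ) + (1 + r) / 2 * (e - t * τ) = e - t * (r * τ) := by ring
  rw [e1] at h1
  rw [e2] at h2
  linarith

/-- The open interval centred at the origin of length `m`. -/
def cIoo (m : ℝ≥0∞) : Set ℝ := {s | ENNReal.ofReal (2 * |s|) < m}

lemma measurableSet_cIoo (m : ℝ≥0∞) : MeasurableSet (cIoo m) :=
  measurableSet_lt (by fun_prop) measurable_const

lemma volume_cIoo {m : ℝ≥0∞} (hm : m ≠ ∞) : volume (cIoo m) = m := by
  have : cIoo m = Ioo (-(m.toReal / 2)) (m.toReal / 2) := by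
    ext s
    rw [cIoo, mem_ofPred_eq, ENNReal.ofReal_lt_iff_lt_toReal (by positivity) hm, mem_Ioo,
      ← abs_lt]
    constructor <;> intro h <;> linarith
  rw [this, Real.volume_Ioo, show m.toReal / 2 - -(m.toReal / 2) = m.toReal by ring,
    ENNReal.ofReal_toReal hm]

/-- Among densities bounded by one, the centred interval minimises the integral of a function
that increases with the distance to the origin. -/
lemma setLIntegral_cIoo_le {F : ℝ → ℝ≥0∞} (hF : Measurable F) (hF1 : ∀ s, F s ≤ 1)
    (hm : ∫⁻ s, F s ≠ ∞) {φ : ℝ → ℝ} (hφ : Measurable φ)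
    (hmono : ∀ {σ τ : ℝ}, |σ| ≤ |τ| → φ σ ≤ φ τ) :
    ∫⁻ s in cIoo (∫⁻ s, F s), ENNReal.ofReal (φ s) ≤ ∫⁻ s, F s * ENNReal.ofReal (φ s) := by
  set m := ∫⁻ s, F s with hmdef
  set l := ENNReal.ofReal (φ (m.toReal / 2)) with hl
  have hI := measurableSet_cIoo m
  have hpt : ∀ s, (cIoo m).indicator (fun s => ENNReal.ofReal (φ s)) s + F s * l ≤
      F s * ENNReal.ofReal (φ s) + (cIoo m).indicator (fun _ => l) s := by
    intro s
    have hlt : l ≠ ∞ := ENNReal.ofReal_ne_top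
    have hst : ENNReal.ofReal (φ s) ≠ ∞ := ENNReal.ofReal_ne_top
    have hFt : F s ≠ ∞ := ((hF1 s).trans_lt ENNReal.one_lt_top).ne
    by_cases hs : s ∈ cIoo m
    · have hle : ENNReal.ofReal (φ s) ≤ l := by
        refine ENNReal.ofReal_le_ofReal (hmono ?_)
        rw [cIoo, mem_ofPred_eq, ENNReal.ofReal_lt_iff_lt_toReal (by positivity) hm] at hs
        rw [abs_of_nonneg (a := m.toReal / 2) (by positivity)]
        linarith
      simp only [indicator_of_mem hs]
      have h1 := hF1 s
      generalize ENNReal.ofReal (φ s) = a at *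
      generalize F s = b at *
      obtain ⟨d, hd⟩ := exists_add_of_le h1
      calc a + b * l = b * a + d * a + b * l := by rw [← add_mul, ← hd, one_mul]
        _ ≤ b * a + d * l + b * l := by gcongr
        _ = b * a + (b + d) * l := by ring
        _ = b * a + l := by rw [← hd, one_mul]
    · have hle : l ≤ ENNReal.ofReal (φ s) := by
        refine ENNReal.ofReal_le_ofReal (hmono ?_)
        rw [cIoo, mem_ofPred_eq, ENNReal.ofReal_lt_iff_lt_toReal (by positivity) hm, not_lt] at hs
        rw [abs_of_nonneg (a := m.toReal / 2) (by positivity)]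
        linarith
      simp only [indicator_of_notMem hs, zero_add, add_zero]
      gcongr
  have hle := lintegral_mono (μ := volume) hpt
  rw [lintegral_add_left ((by fun_prop : Measurable fun s => ENNReal.ofReal (φ s)).indicator hI),
    lintegral_add_right _ (measurable_const.indicator hI), lintegral_indicator hI,
    lintegral_indicator hI, lintegral_mul_const _ hF, ← hmdef, setLIntegral_const,
    volume_cIoo hm, mul_comm m l] at hle
  exact (ENNReal.add_le_add_iff_right (ENNReal.mul_ne_top ENNReal.ofReal_ne_top hm)).1 hle

lemma two_mul_setLIntegral_cIoo_le {p : ℝ} (hp : 1 ≤ p) {F : ℝ → ℝ≥0∞} (hF : Measurable F)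
    (hF1 : ∀ s, F s ≤ 1) (hm : ∫⁻ s, F s ≠ ∞) {t : ℝ} (ht : t ≠ 0) (c d : ℝ) :
    2 * ∫⁻ s in cIoo (∫⁻ s, F s), ENNReal.ofReal (|s * t + (c + d) / 2| ^ p) ≤
      (∫⁻ s, F s * ENNReal.ofReal (|s * t + c| ^ p)) +
        ∫⁻ s, F s * ENNReal.ofReal (|s * -t + d| ^ p) := by
  set e := (c + d) / 2 with he
  set q := (d - c) / (2 * t) with hq
  have hp0 : 0 ≤ p := by linarith
  set φ : ℝ → ℝ := fun σ => |e + t * σ| ^ p + |e - t * σ| ^ p with hφ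
  have hφm : Measurable φ := by fun_prop
  have htr : ∫⁻ s, F (s + q) = ∫⁻ s, F s := lintegral_add_right_eq_self F q
  have key := setLIntegral_cIoo_le (F := fun s => F (s + q)) (by fun_prop) (fun s => hF1 _)
    (by rwa [htr]) hφm (fun h => abs_rpow_add_le_of_abs_le hp e t h)
  rw [htr] at key
  have hE : ∫⁻ s, F (s + q) * ENNReal.ofReal (φ s) =
      (∫⁻ s, F s * ENNReal.ofReal (|s * t + c| ^ p)) +
        ∫⁻ s, F s * ENNReal.ofReal (|s * -t + d| ^ p) := by
    symm
    rw [← lintegral_add_left (by fun_prop), ← lintegral_add_right_eq_self _ q]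
    refine lintegral_congr fun s => ?_
    symm
    rw [hφ, ENNReal.ofReal_add (by positivity) (by positivity), mul_add]
    congr 4
    · congr 1; rw [he, hq]; field_simp; ring
    · congr 1; rw [he, hq]; field_simp; ring
  have hR : ∫⁻ s in cIoo (∫⁻ s, F s), ENNReal.ofReal (φ s) =
      2 * ∫⁻ s in cIoo (∫⁻ s, F s), ENNReal.ofReal (|s * t + e| ^ p) := by
    have hI := measurableSet_cIoo (∫⁻ s, F s)
    have h1 : ∫⁻ s in cIoo (∫⁻ s, F s), ENNReal.ofReal (|e - t * s| ^ p) =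
        ∫⁻ s in cIoo (∫⁻ s, F s), ENNReal.ofReal (|e + t * s| ^ p) := by
      rw [← lintegral_indicator hI, ← lintegral_indicator hI, ← lintegral_neg_eq_self]
      refine lintegral_congr fun s => ?_
      simp only [indicator, cIoo, mem_ofPred_eq, abs_neg]
      congr 1
      ring_nf
    simp only [hφ]
    simp_rw [ENNReal.ofReal_add (rpow_nonneg (abs_nonneg _) p) (rpow_nonneg (abs_nonneg _) p)]
    rw [lintegral_add_left (by fun_prop), h1, ← two_mul]
    congr 3 with s
    ring_nf
  rw [← hR, ← hE]
  exact key

/-- The `p`-th power of the norm of the `L_p` centroid body of the density `f`. -/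
noncomputable def Phi {n : ℕ} (p : ℝ) (f : (Fin n → ℝ) → ℝ≥0∞) (y : Fin n → ℝ) : ℝ≥0∞ :=
  ∫⁻ x, f x * ENNReal.ofReal (|x ⬝ᵥ y| ^ p)

lemma measurable_dotProduct {n : ℕ} :
    Measurable fun q : (Fin n → ℝ) × (Fin n → ℝ) => q.1 ⬝ᵥ q.2 := by
  unfold dotProduct; fun_prop

lemma measurable_Phi {n : ℕ} (p : ℝ) {f : (Fin n → ℝ) → ℝ≥0∞} (hf : Measurable f) :
    Measurable (Phi p f) := by
  refine Measurable.lintegral_prod_right' (f := fun q : (Fin n → ℝ) × (Fin n → ℝ) =>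
    f q.2 * ENNReal.ofReal (|q.2 ⬝ᵥ q.1| ^ p)) ?_
  have : Measurable fun q : (Fin n → ℝ) × (Fin n → ℝ) => q.2 ⬝ᵥ q.1 :=
    measurable_dotProduct.comp measurable_swap
  fun_prop

lemma Phi_neg {n : ℕ} (p : ℝ) (f : (Fin n → ℝ) → ℝ≥0∞) (y : Fin n → ℝ) :
    Phi p f (-y) = Phi p f y := by
  simp [Phi]

variable {n : ℕ} (i : Fin (n + 1))

/-- The mass of `f` along the line through `x` in the `i`-th direction. -/
noncomputable def lineMass (f : (Fin (n + 1) → ℝ) → ℝ≥0∞) (x : Fin n → ℝ) : ℝ≥0∞ :=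
  ∫⁻ s, f (ins i s x)

lemma measurable_lineMass {f : (Fin (n + 1) → ℝ) → ℝ≥0∞} (hf : Measurable f) :
    Measurable (lineMass i f) :=
  (hf.comp (measurable_ins i)).lintegral_prod_left'

/-- Replace each restriction of `f` to a line in the `i`-th direction by the indicator of a
centred interval of the same mass. -/
noncomputable def steiner (f : (Fin (n + 1) → ℝ) → ℝ≥0∞) (x : Fin (n + 1) → ℝ) : ℝ≥0∞ :=
  (cIoo (lineMass i f (i.removeNth x))).indicator 1 (x i)

lemma steiner_ins (f : (Fin (n + 1) → ℝ) → ℝ≥0∞) (s : ℝ) (x : Fin n → ℝ) :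
    steiner i f (ins i s x) = (cIoo (lineMass i f x)).indicator 1 s := by
  simp [steiner]

lemma measurable_steiner {f : (Fin (n + 1) → ℝ) → ℝ≥0∞} (hf : Measurable f) :
    Measurable (steiner i f) := by
  have : MeasurableSet {x : Fin (n + 1) → ℝ | x i ∈ cIoo (lineMass i f (i.removeNth x))} := by
    refine measurableSet_lt (f := fun x : Fin (n + 1) → ℝ => ENNReal.ofReal (2 * |x i|))
      (by fun_prop) ?_
    exact (measurable_lineMass i hf).comp (by unfold Fin.removeNth; fun_prop)
  exact measurable_one.indicator this

lemma steiner_le_one (f : (Fin (n + 1) → ℝ) → ℝ≥0∞) (x : Fin (n + 1) → ℝ) :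
    steiner i f x ≤ 1 := indicator_le_self' (by simp) _

/-- `f` vanishes outside the ball of squared radius `R`. -/
def BallSupp {n : ℕ} (R : ℝ) (f : (Fin n → ℝ) → ℝ≥0∞) : Prop :=
  ∀ x, f x ≠ 0 → x ⬝ᵥ x ≤ R

lemma dotProduct_self_eq_removeNth (x : Fin (n + 1) → ℝ) :
    x ⬝ᵥ x = x i ^ 2 + i.removeNth x ⬝ᵥ i.removeNth x := by
  conv_lhs => rw [← ins_removeNth i x, ins_dotProduct]
  ring

lemma lineMass_le {f : (Fin (n + 1) → ℝ) → ℝ≥0∞} (hf1 : ∀ x, f x ≤ 1) {R : ℝ}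
    (hR : BallSupp R f) (x : Fin n → ℝ) :
    lineMass i f x ≤ ENNReal.ofReal (2 * √(R - x ⬝ᵥ x)) := by
  calc lineMass i f x ≤ ∫⁻ s, (Icc (-√(R - x ⬝ᵥ x)) √(R - x ⬝ᵥ x)).indicator 1 s := by
        refine lintegral_mono fun s => ?_
        by_cases hs : s ∈ Icc (-√(R - x ⬝ᵥ x)) √(R - x ⬝ᵥ x)
        · simpa [indicator_of_mem hs] using hf1 _
        · rw [indicator_of_notMem hs, nonpos_iff_eq_zero]
          by_contra h
          have := hR _ h
          rw [ins_dotProduct] at this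
          exact hs (abs_le.1 (Real.abs_le_sqrt (by linarith)))
    _ = _ := by rw [lintegral_indicator_one measurableSet_Icc, Real.volume_Icc]; ring_nf

lemma lineMass_ne_top {f : (Fin (n + 1) → ℝ) → ℝ≥0∞} (hf1 : ∀ x, f x ≤ 1) {R : ℝ}
    (hR : BallSupp R f) (x : Fin n → ℝ) : lineMass i f x ≠ ∞ :=
  ((lineMass_le i hf1 hR x).trans_lt ENNReal.ofReal_lt_top).ne

lemma BallSupp.steiner {f : (Fin (n + 1) → ℝ) → ℝ≥0∞} (hf1 : ∀ x, f x ≤ 1) {R : ℝ}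
    (hR : BallSupp R f) : BallSupp R (steiner i f) := by
  intro x hx
  rw [LpSantalo.steiner, ne_eq, indicator_apply_eq_zero, not_forall] at hx
  obtain ⟨hx, -⟩ := hx
  have h1 := lt_of_lt_of_le hx (lineMass_le i hf1 hR _)
  rw [ENNReal.ofReal_lt_ofReal_iff_of_nonneg (by positivity),
    mul_lt_mul_iff_right₀ two_pos, Real.lt_sqrt (abs_nonneg _), sq_abs] at h1
  rw [dotProduct_self_eq_removeNth i]
  linarith

lemma lintegral_steiner {f : (Fin (n + 1) → ℝ) → ℝ≥0∞} (hf : Measurable f) (hf1 : ∀ x, f x ≤ 1)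
    {R : ℝ} (hR : BallSupp R f) : ∫⁻ x, steiner i f x = ∫⁻ x, f x := by
  rw [lintegral_ins' i hf, lintegral_ins' i (measurable_steiner i hf)]
  refine lintegral_congr fun x => ?_
  simp_rw [steiner_ins]
  rw [lintegral_indicator_one (measurableSet_cIoo _), volume_cIoo (lineMass_ne_top i hf1 hR x)]
  rfl

lemma steiner_update_neg (f : (Fin (n + 1) → ℝ) → ℝ≥0∞) (x : Fin (n + 1) → ℝ) :
    steiner i f (Function.update x i (-x i)) = steiner i f x := by
  have h : ∀ s m, (cIoo m).indicator (1 : ℝ → ℝ≥0∞) (-s) = (cIoo m).indicator 1 s := by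
    intro s m
    have : -s ∈ cIoo m ↔ s ∈ cIoo m := by simp [cIoo]
    by_cases hs : s ∈ cIoo m
    · simp [hs, this.2 hs]
    · simp [hs, mt this.1 hs]
  simp [steiner, h]

lemma two_mul_Phi_steiner_le {p : ℝ} (hp : 1 ≤ p) {f : (Fin (n + 1) → ℝ) → ℝ≥0∞}
    (hf : Measurable f) (hf1 : ∀ x, f x ≤ 1) {R : ℝ} (hR : BallSupp R f) {t : ℝ} (ht : t ≠ 0)
    (y z : Fin n → ℝ) :
    2 * Phi p (steiner i f) (ins i t ((2 : ℝ)⁻¹ • (y + z))) ≤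
      Phi p f (ins i t y) + Phi p f (ins i (-t) z) := by
  have hm : ∀ {g : (Fin (n + 1) → ℝ) → ℝ≥0∞}, Measurable g → ∀ w,
      Measurable fun x => g x * ENNReal.ofReal (|x ⬝ᵥ w| ^ p) := by
    intro g hg w
    have : Measurable fun x : Fin (n + 1) → ℝ => x ⬝ᵥ w :=
      measurable_dotProduct.comp measurable_prodMk_right
    fun_prop
  have hm' : ∀ {g : (Fin (n + 1) → ℝ) → ℝ≥0∞}, Measurable g → ∀ t w,
      Measurable fun x => ∫⁻ s, g (ins i s x) * ENNReal.ofReal (|ins i s x ⬝ᵥ ins i t w| ^ p) := by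
    intro g hg t w
    exact ((hm hg (ins i t w)).comp (measurable_ins i)).lintegral_prod_left'
  unfold Phi
  rw [lintegral_ins' i (hm (measurable_steiner i hf) _), lintegral_ins' i (hm hf _),
    lintegral_ins' i (hm hf _), ← lintegral_add_left (hm' hf _ _),
    ← lintegral_const_mul _ (hm' (measurable_steiner i hf) _ _)]
  refine lintegral_mono fun x => ?_
  simp only [steiner_ins, ins_dotProduct]
  have := two_mul_setLIntegral_cIoo_le hp (F := fun s => f (ins i s x))
    (hf.comp ((measurable_ins i).comp measurable_prodMk_right)) (fun s => hf1 _)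
    (lineMass_ne_top i hf1 hR x) ht (x ⬝ᵥ y) (x ⬝ᵥ z)
  refine le_trans (le_of_eq ?_) this
  congr 1
  rw [← lintegral_indicator (measurableSet_cIoo _)]
  refine lintegral_congr fun s => ?_
  rw [dotProduct_smul, dotProduct_add, smul_eq_mul, ← div_eq_inv_mul]
  rw [← lineMass]
  by_cases hs : s ∈ cIoo (lineMass i f x)
  · rw [indicator_of_mem hs, indicator_of_mem hs, Pi.one_apply, one_mul]
  · rw [indicator_of_notMem hs, indicator_of_notMem hs, zero_mul]

theorem volume_Phi_le_one_le_steiner {p : ℝ} (hp : 1 ≤ p) {f : (Fin (n + 1) → ℝ) → ℝ≥0∞}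
    (hf : Measurable f) (hf1 : ∀ x, f x ≤ 1) {R : ℝ} (hR : BallSupp R f) :
    volume {y | Phi p f y ≤ 1} ≤ volume {y | Phi p (steiner i f) y ≤ 1} := by
  have hA : MeasurableSet {y | Phi p f y ≤ 1} := measurableSet_le (measurable_Phi p hf)
    measurable_const
  have hA' : MeasurableSet {y | Phi p (steiner i f) y ≤ 1} :=
    measurableSet_le (measurable_Phi p (measurable_steiner i hf)) measurable_const
  rw [← lintegral_indicator_one hA, ← lintegral_indicator_one hA',
    lintegral_ins i (measurable_one.indicator hA), lintegral_ins i (measurable_one.indicator hA')]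
  refine lintegral_mono_ae ?_
  filter_upwards [compl_mem_ae_iff.2 (measure_singleton (0 : ℝ))] with t ht
  have ht : t ≠ 0 := ht
  have hm : ∀ {A : Set (Fin (n + 1) → ℝ)}, MeasurableSet A →
      Measurable fun x => A.indicator (1 : (Fin (n + 1) → ℝ) → ℝ≥0∞) (ins i t x) := fun hA =>
    (measurable_one.indicator hA).comp ((measurable_ins i).comp measurable_prodMk_left)
  have key := prekopaLeindler (hm hA) ((hm hA).comp measurable_neg) (hm hA') fun y z => by
    by_cases hy : Phi p f (ins i t y) ≤ 1
    · by_cases hz : Phi p f (ins i t (-z)) ≤ 1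
      · have h1 := two_mul_Phi_steiner_le i hp hf hf1 hR ht y z
        have e : ins i (-t) z = -ins i t (-z) := by
          ext l
          refine Fin.succAboveCases i ?_ (fun m => ?_) l <;> simp
        rw [e, Phi_neg] at h1
        have h2 : Phi p (steiner i f) (ins i t ((2 : ℝ)⁻¹ • (y + z))) ≤ 1 := by
          have h3 := h1.trans (add_le_add hy hz)
          rwa [one_add_one_eq_two, ← mul_one 2, mul_assoc, one_mul,
            ENNReal.mul_le_mul_iff_right two_ne_zero ENNReal.ofNat_ne_top] at h3
        simp only [Function.comp_apply]
        rw [indicator_of_mem (by exact hy), indicator_of_mem (by exact hz),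
          indicator_of_mem (by exact h2)]
        simp
      · simp [hz]
    · simp [hy]
  have e : ∫⁻ x, ((fun x => {y | Phi p f y ≤ 1}.indicator (1 : (Fin (n + 1) → ℝ) → ℝ≥0∞)
      (ins i t x)) ∘ Neg.neg) x =
      ∫⁻ x, {y | Phi p f y ≤ 1}.indicator (1 : (Fin (n + 1) → ℝ) → ℝ≥0∞) (ins i t x) :=
    lintegral_neg_eq_self (fun x => {y | Phi p f y ≤ 1}.indicator
      (1 : (Fin (n + 1) → ℝ) → ℝ≥0∞) (ins i t x))
  rw [e, ← sq] at key
  exact (ENNReal.pow_le_pow_left_iff two_ne_zero).1 key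

end Steiner

section WeakLimit

variable {α : Type*} [MeasurableSpace α] [MeasurableSpace.CountablyGenerated α]
  {μ : Measure α} [IsFiniteMeasure μ]

/-- Sequential weak compactness of the set of densities bounded by one. -/
lemma exists_weak_limit_real {g : ℕ → α → ℝ} (hg : ∀ k, Measurable (g k)) (hg0 : ∀ k x, 0 ≤ g k x)
    (hg1 : ∀ k x, g k x ≤ 1) :
    ∃ G : α → ℝ, Measurable G ∧ (∀ x, 0 ≤ G x) ∧ (∀ x, G x ≤ 1) ∧ ∃ φ : ℕ → ℕ, StrictMono φ ∧
      ∀ h : α → ℝ, Measurable h → ∀ C, (∀ x, |h x| ≤ C) →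
        Filter.Tendsto (fun k => ∫ x, g (φ k) x * h x ∂μ) Filter.atTop
          (nhds (∫ x, G x * h x ∂μ)) := by
  have hmem : ∀ k, MemLp (g k) 2 μ := fun k =>
    .of_bound (hg k).aestronglyMeasurable 1 (.of_forall fun x => by
      rw [Real.norm_eq_abs, abs_of_nonneg (hg0 k x)]; exact hg1 k x)
  set u : ℕ → Lp ℝ 2 μ := fun k => (hmem k).toLp
  obtain ⟨r, hr⟩ : ∃ r, ∀ k, ‖u k‖ ≤ r := by
    refine ⟨(μ univ).toReal ^ (2 : ℝ≥0∞).toReal⁻¹ * 1, fun k => ?_⟩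
    refine Lp.norm_le_of_ae_bound zero_le_one ?_
    filter_upwards [(hmem k).coeFn_toLp] with x hx
    rw [hx, Real.norm_eq_abs, abs_of_nonneg (hg0 k x)]
    exact hg1 k x
  set w : ℕ → WeakDual ℝ (Lp ℝ 2 μ) := fun k =>
    StrongDual.toWeakDual (InnerProductSpace.toDual ℝ _ (u k))
  have : Fact ((2 : ℝ≥0∞) ≠ ∞) := ⟨ENNReal.ofNat_ne_top⟩
  obtain ⟨a, -, φ, hφ, ha⟩ := WeakDual.isSeqCompact_closedBall ℝ (Lp ℝ 2 μ) 0 r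
    (x := w) (fun k => by simpa [w] using hr k)
  set v : Lp ℝ 2 μ := (InnerProductSpace.toDual ℝ _).symm (WeakDual.toStrongDual a)
  have hconv : ∀ h : α → ℝ, Measurable h → ∀ C, (∀ x, |h x| ≤ C) →
      Filter.Tendsto (fun k => ∫ x, g (φ k) x * h x ∂μ) Filter.atTop
          (nhds (∫ x, v x * h x ∂μ)) := by
    intro h hh C hC
    have hhm : MemLp h 2 μ := .of_bound hh.aestronglyMeasurable C (.of_forall hC)
    have h1 := (tendsto_iff_forall_eval_tendsto_topDualPairing.1 ha) hhm.toLp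
    have e1 : ∀ k, ∫ x, g (φ k) x * h x ∂μ = (topDualPairing ℝ (Lp ℝ 2 μ)) ((w ∘ φ) k) hhm.toLp := by
      intro k
      have : (topDualPairing ℝ (Lp ℝ 2 μ)) ((w ∘ φ) k) hhm.toLp = inner ℝ (u (φ k)) hhm.toLp := by
        rfl
      rw [this, L2.inner_def]
      refine integral_congr_ae ?_
      filter_upwards [(hmem (φ k)).coeFn_toLp, hhm.coeFn_toLp] with x hx hx'
      rw [hx, hx', RCLike.inner_apply, conj_trivial, mul_comm]
    have e2 : ∫ x, v x * h x ∂μ = (topDualPairing ℝ (Lp ℝ 2 μ)) a hhm.toLp := by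
      have : (topDualPairing ℝ (Lp ℝ 2 μ)) a hhm.toLp = inner ℝ v hhm.toLp := by
        rw [InnerProductSpace.toDual_symm_apply]
        rfl
      rw [this, L2.inner_def]
      refine integral_congr_ae ?_
      filter_upwards [hhm.coeFn_toLp] with x hx'
      rw [hx', RCLike.inner_apply, conj_trivial, mul_comm]
    simp_rw [e1, e2]
    exact h1
  have hvint : Integrable v μ := (Lp.memLp v).integrable (by norm_num)
  have hgint : ∀ k, Integrable (g k) μ := fun k => (hmem k).integrable (by norm_num)
  have hset : ∀ s, MeasurableSet s → Filter.Tendsto (fun k => ∫ x in s, g (φ k) x ∂μ) Filter.atTop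
      (nhds (∫ x in s, v x ∂μ)) := by
    intro s hs
    have := hconv (s.indicator 1) (measurable_one.indicator hs) 1 fun x => by
      by_cases hx : x ∈ s <;> simp [hx]
    have e : ∀ F : α → ℝ, ∫ x, F x * s.indicator 1 x ∂μ = ∫ x in s, F x ∂μ := by
      intro F
      rw [← integral_indicator hs]
      congr with x
      by_cases hx : x ∈ s <;> simp [hx]
    simpa only [e] using this
  have hv0 : 0 ≤ᵐ[μ] v := ae_nonneg_of_forall_setIntegral_nonneg hvint fun s hs _ =>
    ge_of_tendsto' (hset s hs) fun k => setIntegral_nonneg hs fun x _ => hg0 _ x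
  have hv1 : v ≤ᵐ[μ] fun _ => 1 := ae_le_of_forall_setIntegral_le hvint (integrable_const 1)
    fun s hs _ => le_of_tendsto' (hset s hs) fun k =>
      setIntegral_mono_on (hgint _).integrableOn (integrable_const _).integrableOn hs
        fun x _ => hg1 _ x
  obtain ⟨V, hV, hVv⟩ := (Lp.aestronglyMeasurable v).aemeasurable
  refine ⟨fun x => max 0 (min 1 (V x)), by fun_prop, fun x => le_max_left _ _,
    fun x => max_le zero_le_one (min_le_left _ _), φ, hφ, fun h hh C hC => ?_⟩
  convert hconv h hh C hC using 2
  refine integral_congr_ae ?_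
  filter_upwards [hVv, hv0, hv1] with x h1 h2 h3
  rw [← h1, min_eq_right h3, max_eq_right (by exact h2)]

lemma exists_weak_limit {g : ℕ → α → ℝ≥0∞} (hg : ∀ k, Measurable (g k))
    (hg1 : ∀ k x, g k x ≤ 1) :
    ∃ G : α → ℝ≥0∞, Measurable G ∧ (∀ x, G x ≤ 1) ∧ ∃ φ : ℕ → ℕ, StrictMono φ ∧
      ∀ h : α → ℝ, Measurable h → (∀ x, 0 ≤ h x) → ∀ C, (∀ x, h x ≤ C) →
        Filter.Tendsto (fun k => ∫⁻ x, g (φ k) x * ENNReal.ofReal (h x) ∂μ) Filter.atTop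
          (nhds (∫⁻ x, G x * ENNReal.ofReal (h x) ∂μ)) := by
  have hgt : ∀ k x, g k x ≠ ∞ := fun k x => ((hg1 k x).trans_lt ENNReal.one_lt_top).ne
  obtain ⟨G, hG, hG0, hG1, φ, hφ, H⟩ := exists_weak_limit_real (μ := μ)
    (g := fun k x => (g k x).toReal) (fun k => (hg k).ennreal_toReal)
    (fun k x => ENNReal.toReal_nonneg) (fun k x => ENNReal.toReal_mono ENNReal.one_ne_top (hg1 k x))
  refine ⟨fun x => ENNReal.ofReal (G x), by fun_prop, fun x => by simpa using hG1 x, φ, hφ,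
    fun h hh hh0 C hC => ?_⟩
  have e : ∀ F : α → ℝ, Measurable F → (∀ x, 0 ≤ F x) → (∀ x, F x ≤ 1) →
      ∫⁻ x, ENNReal.ofReal (F x) * ENNReal.ofReal (h x) ∂μ =
        ENNReal.ofReal (∫ x, F x * h x ∂μ) := by
    intro F hF hF0 hF1
    rw [ofReal_integral_eq_lintegral_ofReal]
    · refine lintegral_congr fun x => ?_
      rw [ENNReal.ofReal_mul (hF0 x)]
    · refine Integrable.of_bound (hF.mul hh).aestronglyMeasurable C (.of_forall fun x => ?_)
      rw [Real.norm_eq_abs, abs_of_nonneg (mul_nonneg (hF0 x) (hh0 x))]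
      nlinarith [hF0 x, hF1 x, hh0 x, hC x]
    · exact .of_forall fun x => mul_nonneg (hF0 x) (hh0 x)
  rw [e G hG hG0 hG1]
  have e' : ∀ k, ∫⁻ x, g (φ k) x * ENNReal.ofReal (h x) ∂μ =
      ENNReal.ofReal (∫ x, (g (φ k) x).toReal * h x ∂μ) := by
    intro k
    rw [← e _ (hg _).ennreal_toReal (fun x => ENNReal.toReal_nonneg)
      (fun x => ENNReal.toReal_mono ENNReal.one_ne_top (hg1 _ x))]
    refine lintegral_congr fun x => ?_
    rw [ENNReal.ofReal_toReal (hgt _ x)]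
  simp_rw [e']
  refine (ENNReal.continuous_ofReal.tendsto _).comp (H h hh C fun x => ?_)
  rw [abs_of_nonneg (hh0 x)]
  exact hC x

end WeakLimit

section Householder

variable {n : ℕ}

lemma continuous_dotProduct_left {n : ℕ} (y : Fin n → ℝ) :
    Continuous fun x : Fin n → ℝ => x ⬝ᵥ y := by
  unfold dotProduct; fun_prop

lemma continuous_dotProduct_self {n : ℕ} :
    Continuous fun x : Fin n → ℝ => x ⬝ᵥ x := by
  unfold dotProduct; fun_prop

lemma dotProduct_self_nonneg' (x : Fin n → ℝ) : 0 ≤ x ⬝ᵥ x :=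
  Finset.sum_nonneg fun _ _ => mul_self_nonneg _

/-- The reflection in the hyperplane orthogonal to `w`. -/
noncomputable def refl (w : Fin n → ℝ) : (Fin n → ℝ) →ₗ[ℝ] (Fin n → ℝ) where
  toFun x := x - (2 * (x ⬝ᵥ w) / (w ⬝ᵥ w)) • w
  map_add' x y := by
    rw [add_dotProduct, mul_add, add_div, add_smul]
    abel
  map_smul' c x := by
    rw [smul_dotProduct, smul_eq_mul, RingHom.id_apply, smul_sub, smul_smul]
    ring_nf

lemma refl_apply (w x : Fin n → ℝ) : refl w x = x - (2 * (x ⬝ᵥ w) / (w ⬝ᵥ w)) • w := rfl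

lemma refl_dotProduct_refl (w x y : Fin n → ℝ) : refl w x ⬝ᵥ refl w y = x ⬝ᵥ y := by
  rcases eq_or_ne (w ⬝ᵥ w) 0 with h | h
  · simp [refl_apply, h]
  · simp only [refl_apply, sub_dotProduct, dotProduct_sub, smul_dotProduct, dotProduct_smul,
      smul_eq_mul, dotProduct_comm w y]
    field_simp
    ring

lemma refl_refl (w x : Fin n → ℝ) : refl w (refl w x) = x := by
  rcases eq_or_ne (w ⬝ᵥ w) 0 with h | h
  · simp [refl_apply, h]
  · have : refl w x ⬝ᵥ w = -(x ⬝ᵥ w) := by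
      simp only [refl_apply, sub_dotProduct, smul_dotProduct, smul_eq_mul]
      field_simp
      ring
    rw [refl_apply w (refl w x), this, refl_apply, sub_sub, ← add_smul]
    rw [mul_neg, neg_div, add_neg_cancel, zero_smul, sub_zero]

lemma refl_dotProduct (w x y : Fin n → ℝ) : refl w x ⬝ᵥ y = x ⬝ᵥ refl w y := by
  rw [← refl_dotProduct_refl w x, refl_refl]

lemma refl_sub_self {a b : Fin n → ℝ} (h : a ⬝ᵥ a = b ⬝ᵥ b) : refl (a - b) a = b := by
  rcases eq_or_ne a b with rfl | hab
  · simp [refl_apply]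
  · have h1 : (a - b) ⬝ᵥ (a - b) ≠ 0 := by
      rw [ne_eq, dotProduct_self_eq_zero, sub_eq_zero]; exact hab
    have h2 : 2 * (a ⬝ᵥ (a - b)) = (a - b) ⬝ᵥ (a - b) := by
      simp only [sub_dotProduct, dotProduct_sub, dotProduct_comm b a, h]; ring
    rw [refl_apply, h2, div_self h1, one_smul, sub_sub_cancel]

lemma refl_smul {c : ℝ} (hc : c ≠ 0) (w x : Fin n → ℝ) : refl (c • w) x = refl w x := by
  rcases eq_or_ne (w ⬝ᵥ w) 0 with h | h
  · simp [refl_apply, h]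
  · simp only [refl_apply, dotProduct_smul, smul_dotProduct, smul_eq_mul, smul_smul]
    congr 2
    field_simp

lemma refl_conj (w v x : Fin n → ℝ) : refl w (refl v (refl w x)) = refl (refl w v) x := by
  rw [refl_apply v, map_sub, map_smul, refl_refl, refl_dotProduct, refl_apply (refl w v),
    refl_dotProduct_refl]

lemma continuous_refl (w : Fin n → ℝ) : Continuous (refl w) :=
  LinearMap.continuous_of_finiteDimensional _

lemma measurePreserving_refl (w : Fin n → ℝ) : MeasurePreserving (refl w) := by
  refine ⟨(continuous_refl w).measurable, ?_⟩
  have h1 : LinearMap.det (refl w) * LinearMap.det (refl w) = 1 := by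
    rw [← LinearMap.det_comp, ← LinearMap.det_id (M := Fin n → ℝ)]
    congr 1
    ext1 x
    ext
    simp [refl_refl]
  have h0 : LinearMap.det (refl w) ≠ 0 := left_ne_zero_of_mul_eq_one h1
  rw [Real.map_linearMap_volume_pi_eq_smul_volume_pi h0]
  have : |(LinearMap.det (refl w))⁻¹| = 1 := by
    rcases mul_self_eq_one_iff.1 h1 with h | h <;> simp [h]
  simp [this]

lemma refl_single_zero {n : ℕ} (x : Fin (n + 1) → ℝ) :
    refl (Pi.single 0 1) x = Function.update x 0 (-x 0) := by
  ext j
  rcases eq_or_ne j 0 with rfl | hj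
  · simp [refl_apply]; ring
  · simp [refl_apply, hj]

end Householder

section Phi

variable {n : ℕ} {p : ℝ}

lemma lintegral_comp_refl (w : Fin n → ℝ) {F : (Fin n → ℝ) → ℝ≥0∞} (hF : Measurable F) :
    ∫⁻ x, F (refl w x) = ∫⁻ x, F x :=
  (measurePreserving_refl w).lintegral_comp hF

lemma measurable_Phi_integrand (p : ℝ) {f : (Fin n → ℝ) → ℝ≥0∞} (hf : Measurable f)
    (y : Fin n → ℝ) : Measurable fun x => f x * ENNReal.ofReal (|x ⬝ᵥ y| ^ p) := by
  have := (continuous_dotProduct_left y).measurable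
  fun_prop

lemma Phi_comp_refl (p : ℝ) {f : (Fin n → ℝ) → ℝ≥0∞} (hf : Measurable f) (w y : Fin n → ℝ) :
    Phi p (fun x => f (refl w x)) y = Phi p f (refl w y) := by
  unfold Phi
  rw [← lintegral_comp_refl w (measurable_Phi_integrand p hf _)]
  simp_rw [refl_dotProduct_refl]

lemma Phi_smul (p : ℝ) {f : (Fin n → ℝ) → ℝ≥0∞} (hf : Measurable f) (r : ℝ)
    (y : Fin n → ℝ) : Phi p f (r • y) = ENNReal.ofReal (|r| ^ p) * Phi p f y := by
  unfold Phi
  rw [← lintegral_const_mul _ (measurable_Phi_integrand p hf y)]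
  refine lintegral_congr fun x => ?_
  rw [dotProduct_smul, smul_eq_mul, abs_mul, mul_rpow (abs_nonneg _) (abs_nonneg _),
    ENNReal.ofReal_mul (by positivity)]
  ring

/-- The squared-radius `R` centred ball. -/
def dotBall (n : ℕ) (R : ℝ) : Set (Fin n → ℝ) := {x | x ⬝ᵥ x ≤ R}

lemma abs_apply_le_of_mem_dotBall {R : ℝ} {x : Fin n → ℝ} (hx : x ∈ dotBall n R) (j : Fin n) :
    |x j| ≤ √R := by
  refine Real.abs_le_sqrt (le_trans ?_ hx)
  rw [sq]
  exact Finset.single_le_sum (f := fun i => x i * x i) (fun i _ => mul_self_nonneg _)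
    (Finset.mem_univ j)

lemma isCompact_dotBall (n : ℕ) (R : ℝ) : IsCompact (dotBall n R) := by
  refine Metric.isCompact_of_isClosed_isBounded
    (isClosed_le continuous_dotProduct_self continuous_const) ?_
  refine (Metric.isBounded_closedBall (x := (0 : Fin n → ℝ)) (r := √R)).subset fun x hx => ?_
  rw [mem_closedBall_zero_iff, pi_norm_le_iff_of_nonneg (Real.sqrt_nonneg R)]
  exact abs_apply_le_of_mem_dotBall hx

/-- The densities among which the second moment is minimised. -/
structure Adm (p R : ℝ) (m v : ℝ≥0∞) (g : (Fin (n + 1) → ℝ) → ℝ≥0∞) : Prop where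
  meas : Measurable g
  le_one : ∀ x, g x ≤ 1
  supp : BallSupp R g
  mass : ∫⁻ x, g x = m
  vol : v ≤ volume {y | Phi p g y ≤ 1}

variable {R : ℝ} {m v : ℝ≥0∞} {g : (Fin (n + 1) → ℝ) → ℝ≥0∞}

lemma Adm.comp_refl (hg : Adm p R m v g) (w : Fin (n + 1) → ℝ) :
    Adm p R m v (fun x => g (refl w x)) where
  meas := hg.meas.comp (continuous_refl w).measurable
  le_one x := hg.le_one _
  supp x hx := by
    have := hg.supp _ hx
    rwa [refl_dotProduct_refl] at this
  mass := (lintegral_comp_refl w hg.meas).trans hg.mass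
  vol := by
    have h : MeasurableSet {y | Phi p g y ≤ 1} :=
      measurableSet_le (measurable_Phi p hg.meas) measurable_const
    simp_rw [Phi_comp_refl p hg.meas]
    refine hg.vol.trans_eq ?_
    rw [← (measurePreserving_refl w).measure_preimage h.nullMeasurableSet]
    rfl

lemma Adm.steiner (hp : 1 ≤ p) (hg : Adm p R m v g) (i : Fin (n + 1)) :
    Adm p R m v (steiner i g) where
  meas := measurable_steiner i hg.meas
  le_one := steiner_le_one i g
  supp := hg.supp.steiner i hg.le_one
  mass := (lintegral_steiner i hg.meas hg.le_one hg.supp).trans hg.mass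
  vol := hg.vol.trans (volume_Phi_le_one_le_steiner i hp hg.meas hg.le_one hg.supp)

/-- The second moment of a density. -/
noncomputable def moment {n : ℕ} (g : (Fin n → ℝ) → ℝ≥0∞) : ℝ≥0∞ :=
  ∫⁻ x, g x * ENNReal.ofReal (x ⬝ᵥ x)

lemma moment_comp_refl (hg : Measurable g) (w : Fin (n + 1) → ℝ) :
    moment (fun x => g (refl w x)) = moment g := by
  have := (continuous_dotProduct_self (n := n + 1)).measurable
  unfold moment
  rw [← lintegral_comp_refl w (F := fun x => g x * ENNReal.ofReal (x ⬝ᵥ x)) (by fun_prop)]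
  simp_rw [refl_dotProduct_refl]

lemma lintegral_steiner_mul (i : Fin (n + 1)) (hg : Measurable g) (hg1 : ∀ x, g x ≤ 1)
    (hR : BallSupp R g) {q : (Fin n → ℝ) → ℝ≥0∞} (hq : Measurable q) :
    ∫⁻ x, steiner i g x * q (i.removeNth x) = ∫⁻ x, g x * q (i.removeNth x) := by
  have hr : Measurable fun x : Fin (n + 1) → ℝ => i.removeNth x := by
    unfold Fin.removeNth; fun_prop
  have hi : ∀ x, Measurable fun s : ℝ => g (ins i s x) := fun x =>
    hg.comp ((measurable_ins i).comp measurable_prodMk_right)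
  rw [lintegral_ins' i (F := fun x => g x * q (i.removeNth x)) (hg.mul (hq.comp hr)),
    lintegral_ins' i (F := fun x => steiner i g x * q (i.removeNth x))
      ((measurable_steiner i hg).mul (hq.comp hr))]
  refine lintegral_congr fun x => ?_
  simp_rw [steiner_ins, removeNth_ins]
  rw [lintegral_mul_const _ (measurable_one.indicator (measurableSet_cIoo _)),
    lintegral_mul_const _ (hi x),
    lintegral_indicator_one (measurableSet_cIoo _), volume_cIoo (lineMass_ne_top i hg1 hR x)]
  rfl

lemma lintegral_mul_ofReal_ne_top (hg1 : ∀ x, g x ≤ 1) (hR : BallSupp R g)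
    {h : (Fin (n + 1) → ℝ) → ℝ≥0∞} {C : ℝ≥0∞} (hC : C ≠ ∞) (hh : ∀ x ∈ dotBall (n + 1) R, h x ≤ C) :
    ∫⁻ x, g x * h x ≠ ∞ := by
  refine ne_top_of_le_ne_top (b := ∫⁻ x in dotBall (n + 1) R, C) ?_ ?_
  · rw [setLIntegral_const]
    exact ENNReal.mul_ne_top hC (isCompact_dotBall _ _).measure_ne_top
  · rw [← lintegral_indicator (isCompact_dotBall _ _).measurableSet]
    refine lintegral_mono fun x => ?_
    by_cases hx : x ∈ dotBall (n + 1) R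
    · rw [indicator_of_mem hx]
      calc g x * h x ≤ 1 * C := by gcongr; exacts [hg1 x, hh x hx]
        _ = C := one_mul C
    · have : g x = 0 := by
        by_contra h
        exact hx (hR x h)
      simp [this]

lemma volume_two_mul_abs_eq (i : Fin (n + 1)) {M : (Fin n → ℝ) → ℝ≥0∞} (hM : Measurable M) :
    volume {x : Fin (n + 1) → ℝ | ENNReal.ofReal (2 * |x i|) = M (i.removeNth x)} = 0 := by
  have hr : Measurable fun x : Fin (n + 1) → ℝ => i.removeNth x := by
    unfold Fin.removeNth; fun_prop
  have hS : MeasurableSet {x : Fin (n + 1) → ℝ | ENNReal.ofReal (2 * |x i|) = M (i.removeNth x)} :=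
    measurableSet_eq_fun (by fun_prop) (hM.comp hr)
  rw [← lintegral_indicator_one hS, lintegral_ins' i (measurable_one.indicator hS)]
  refine (lintegral_congr fun x => ?_).trans lintegral_zero
  rw [← lintegral_zero (μ := (volume : Measure ℝ))]
  refine lintegral_congr_ae ?_
  have hfin : volume ({(M x).toReal / 2, -((M x).toReal / 2)} : Set ℝ) = 0 :=
    (Set.toFinite _).measure_zero _
  filter_upwards [compl_mem_ae_iff.2 hfin] with s hs
  rw [indicator_of_notMem]
  intro h
  rw [mem_ofPred_eq, ins_same, removeNth_ins] at h
  refine hs ?_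
  have h2 : (M x).toReal / 2 = |s| := by
    rw [← h, ENNReal.toReal_ofReal (by positivity)]; ring
  rw [h2]
  rcases abs_cases s with h | h <;> simp [h.1]

lemma eq_of_bathtub_eq {a l b : ℝ≥0∞} (ha : a ≠ ∞) (hl : l ≠ ∞) (hb : b ≤ 1) (hal : a ≠ l)
    (h : a + b * l = b * a + l) : b = 1 := by
  have hb' : b ≠ ∞ := ne_top_of_le_ne_top ENNReal.one_ne_top hb
  lift a to NNReal using ha
  lift l to NNReal using hl
  lift b to NNReal using hb'
  norm_cast at *
  have h1 : (a : ℝ) + b * l = b * a + l := by exact_mod_cast h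
  have h2 : (a : ℝ) ≠ l := by exact_mod_cast hal
  have h3 : ((b : ℝ) - 1) * (l - a) = 0 := by linear_combination h1
  rcases mul_eq_zero.1 h3 with h3 | h3
  · exact_mod_cast (sub_eq_zero.1 h3)
  · exact absurd (sub_eq_zero.1 h3).symm h2

lemma bathtub_le {a l b : ℝ≥0∞} (hb : b ≤ 1) (hal : a ≤ l) : a + b * l ≤ b * a + l := by
  obtain ⟨d, hd⟩ := exists_add_of_le hb
  calc a + b * l = b * a + d * a + b * l := by rw [← add_mul, ← hd, one_mul]
    _ ≤ b * a + d * l + b * l := by gcongr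
    _ = b * a + (b + d) * l := by ring
    _ = b * a + l := by rw [← hd, one_mul]

lemma steiner_ae_eq_of_moment_le (i : Fin (n + 1)) (hg : Measurable g) (hg1 : ∀ x, g x ≤ 1)
    (hR : BallSupp R g) (h : moment g ≤ moment (steiner i g)) : steiner i g =ᵐ[volume] g := by
  have hr : Measurable fun x : Fin (n + 1) → ℝ => i.removeNth x := by
    unfold Fin.removeNth; fun_prop
  set q : (Fin n → ℝ) → ℝ≥0∞ := fun x => ENNReal.ofReal (x ⬝ᵥ x)
  have hq : Measurable q := (continuous_dotProduct_self (n := n)).measurable.ennreal_ofReal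
  set l : (Fin n → ℝ) → ℝ≥0∞ := fun x => ENNReal.ofReal (((lineMass i g x).toReal / 2) ^ 2)
  have hl : Measurable l := by
    have := measurable_lineMass i hg
    fun_prop
  set a : (Fin (n + 1) → ℝ) → ℝ≥0∞ := fun x => ENNReal.ofReal (x i ^ 2)
  have ha : Measurable a := by fun_prop
  set f := steiner i g with hfdef
  have hf : Measurable f := measurable_steiner i hg
  have hf1 : ∀ x, f x ≤ 1 := steiner_le_one i g
  have hfR : BallSupp R f := hR.steiner i hg1
  have hlr : Measurable fun x : Fin (n + 1) → ℝ => l (i.removeNth x) := hl.comp hr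
  have hma : ∀ {F : (Fin (n + 1) → ℝ) → ℝ≥0∞}, Measurable F →
      Measurable fun x => F x * a x := fun hF => hF.mul ha
  have hR' : ∀ x : Fin (n + 1) → ℝ, x ∈ dotBall (n + 1) R → x ⬝ᵥ x ≤ R := fun x hx => hx
  have hfin : ∀ F : (Fin (n + 1) → ℝ) → ℝ≥0∞, (∀ x, F x ≤ 1) → BallSupp R F →
      ∫⁻ x, F x * q (i.removeNth x) ≠ ∞ := fun F h1 h2 =>
    lintegral_mul_ofReal_ne_top h1 h2 (C := ENNReal.ofReal R) ENNReal.ofReal_ne_top fun x hx =>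
      ENNReal.ofReal_le_ofReal (by
        have := hR' x hx
        rw [dotProduct_self_eq_removeNth i] at this
        nlinarith [sq_nonneg (x i)])
  have hfina : ∀ F : (Fin (n + 1) → ℝ) → ℝ≥0∞, (∀ x, F x ≤ 1) → BallSupp R F →
      ∫⁻ x, F x * a x ≠ ∞ := fun F h1 h2 =>
    lintegral_mul_ofReal_ne_top h1 h2 (C := ENNReal.ofReal R) ENNReal.ofReal_ne_top fun x hx =>
      ENNReal.ofReal_le_ofReal (by
        have := hR' x hx
        rw [dotProduct_self_eq_removeNth i] at this
        nlinarith [dotProduct_self_nonneg' (i.removeNth x)])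
  have hmass : ∀ x, (lineMass i g x).toReal ≤ 2 * √R := fun x => by
    refine (ENNReal.toReal_le_of_le_ofReal (by positivity) (lineMass_le i hg1 hR x)).trans ?_
    gcongr
    linarith [dotProduct_self_nonneg' x]
  have hfinl : ∀ F : (Fin (n + 1) → ℝ) → ℝ≥0∞, (∀ x, F x ≤ 1) → BallSupp R F →
      ∫⁻ x, F x * l (i.removeNth x) ≠ ∞ := fun F h1 h2 =>
    lintegral_mul_ofReal_ne_top h1 h2 (C := ENNReal.ofReal (√R ^ 2)) ENNReal.ofReal_ne_top
      fun x _ => ENNReal.ofReal_le_ofReal (by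
        have := hmass (i.removeNth x)
        gcongr
        linarith)
  have hmom : ∀ F : (Fin (n + 1) → ℝ) → ℝ≥0∞, Measurable F →
      moment F = (∫⁻ x, F x * a x) + ∫⁻ x, F x * q (i.removeNth x) := by
    intro F hF
    rw [moment, ← lintegral_add_left (hma hF)]
    refine lintegral_congr fun x => ?_
    rw [dotProduct_self_eq_removeNth i, ENNReal.ofReal_add (sq_nonneg _)
      (dotProduct_self_nonneg' _), mul_add]
  have ha_le : ∫⁻ x, g x * a x ≤ ∫⁻ x, f x * a x := by
    rw [hmom g hg, hmom f hf, lintegral_steiner_mul i hg hg1 hR hq] at h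
    exact (ENNReal.add_le_add_iff_right (hfin g hg1 hR)).1 h
  have hcase : ∀ x, (f x = 1 ∧ a x ≤ l (i.removeNth x)) ∨
      (f x = 0 ∧ l (i.removeNth x) ≤ a x) := by
    intro x
    have hm := lineMass_ne_top i hg1 hR (i.removeNth x)
    have hx : x i ∈ cIoo (lineMass i g (i.removeNth x)) ↔
        2 * |x i| < (lineMass i g (i.removeNth x)).toReal := by
      rw [cIoo, mem_ofPred_eq, ENNReal.ofReal_lt_iff_lt_toReal (by positivity) hm]
    by_cases h : x i ∈ cIoo (lineMass i g (i.removeNth x))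
    · refine Or.inl ⟨indicator_of_mem h _, ENNReal.ofReal_le_ofReal ?_⟩
      rw [← sq_abs]
      gcongr
      linarith [hx.1 h]
    · refine Or.inr ⟨indicator_of_notMem h _, ENNReal.ofReal_le_ofReal ?_⟩
      rw [← sq_abs (x i)]
      rw [hx, not_lt] at h
      gcongr
      linarith
  have hpt : ∀ x, f x * a x + g x * l (i.removeNth x) ≤ g x * a x + f x * l (i.removeNth x) := by
    intro x
    rcases hcase x with ⟨h1, h2⟩ | ⟨h1, h2⟩
    · rw [h1, one_mul, one_mul]
      exact bathtub_le (hg1 x) h2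
    · rw [h1, zero_mul, zero_mul, zero_add, add_zero]
      gcongr
  have hae := ae_eq_of_ae_le_of_lintegral_le (μ := volume) (.of_forall hpt)
    (by
      rw [lintegral_add_left (hma hf)]
      exact ENNReal.add_ne_top.2 ⟨hfina f hf1 hfR, hfinl g hg1 hR⟩)
    ((hg.mul ha).add (hf.mul hlr)).aemeasurable
    (by
      rw [lintegral_add_left (hma hf), lintegral_add_left (hma hg),
        lintegral_steiner_mul i hg hg1 hR hl]
      gcongr)
  have hne := measure_eq_zero_iff_ae_notMem.1 (volume_two_mul_abs_eq i (measurable_lineMass i hg))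
  filter_upwards [hae, hne] with x h1 h2
  have hal : a x ≠ l (i.removeNth x) := by
    intro h
    refine h2 ?_
    have hm := lineMass_ne_top i hg1 hR (i.removeNth x)
    rw [ENNReal.ofReal_eq_ofReal_iff (sq_nonneg _) (sq_nonneg _), ← sq_abs,
      sq_eq_sq₀ (abs_nonneg _) (by positivity)] at h
    show ENNReal.ofReal (2 * |x i|) = _
    rw [h, mul_div_cancel₀ _ two_ne_zero, ENNReal.ofReal_toReal hm]
  rcases hcase x with ⟨h3, h4⟩ | ⟨h3, h4⟩
  · rw [h3, one_mul, one_mul] at h1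
    rw [h3, eq_of_bathtub_eq ENNReal.ofReal_ne_top ENNReal.ofReal_ne_top (hg1 x) hal h1]
  · rw [h3, zero_mul, zero_mul, zero_add, add_zero] at h1
    rw [h3]
    by_contra h0
    refine hal ?_
    exact ((ENNReal.mul_right_inj (Ne.symm h0)
      (ne_top_of_le_ne_top ENNReal.one_ne_top (hg1 x))).1 h1).symm

end Phi

section Minimizer

variable {n : ℕ} {p R : ℝ} {m v : ℝ≥0∞}

lemma lintegral_half_le_Phi (hp : 0 ≤ p) (hm : m ≠ 0) (hmt : m ≠ ∞) :
    ∃ C : ℝ≥0∞, C ≠ ∞ ∧ ∀ g : (Fin (n + 1) → ℝ) → ℝ≥0∞, Measurable g → (∀ x, g x ≤ 1) →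
      BallSupp R g → ∫⁻ x, g x = m → m / 2 ≤ C * Phi p g (Pi.single 0 1) := by
  obtain ⟨δ, hδ, hδm⟩ := ENNReal.exists_nnreal_pos_mul_lt
    (a := ENNReal.ofReal 2 * ENNReal.ofReal (2 * √R) ^ n) (b := m / 2)
    (ENNReal.mul_ne_top ENNReal.ofReal_ne_top (ENNReal.pow_ne_top ENNReal.ofReal_ne_top))
    (ENNReal.div_ne_zero.2 ⟨hm, ENNReal.ofNat_ne_top⟩)
  have hδ' : (0 : ℝ) < δ := hδ
  set S : Set (Fin (n + 1) → ℝ) :=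
    Set.pi univ (Fin.cons (Icc (-(δ : ℝ)) δ) fun _ => Icc (-√R) √R) with hS
  have hSm : MeasurableSet S := by
    refine MeasurableSet.univ_pi fun j => ?_
    refine Fin.cases ?_ (fun j => ?_) j
    · exact measurableSet_Icc
    · exact measurableSet_Icc
  have hSv : volume S ≤ m / 2 := by
    refine le_trans (le_of_eq ?_) hδm.le
    rw [hS, volume_pi_pi, Fin.prod_univ_succ]
    simp only [Fin.cons_zero, Fin.cons_succ, Real.volume_Icc, Finset.prod_const,
      Finset.card_univ, Fintype.card_fin]
    rw [← mul_assoc, show (δ : ℝ≥0∞) = ENNReal.ofReal δ by simp,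
      ← ENNReal.ofReal_mul (by positivity)]
    ring_nf
  refine ⟨ENNReal.ofReal ((δ : ℝ) ^ p)⁻¹, ENNReal.ofReal_ne_top, fun g hg hg1 hgR hgm => ?_⟩
  have hpt : ∀ x, g x ≤ S.indicator 1 x + ENNReal.ofReal ((δ : ℝ) ^ p)⁻¹ *
      (g x * ENNReal.ofReal (|x ⬝ᵥ Pi.single 0 1| ^ p)) := by
    intro x
    by_cases hx : x ∈ S
    · rw [indicator_of_mem hx]
      exact (hg1 x).trans le_self_add
    · rw [indicator_of_notMem hx, zero_add]
      by_cases hgx : g x = 0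
      · simp [hgx]
      have hxR : x ∈ dotBall (n + 1) R := hgR x hgx
      have hδx : (δ : ℝ) ≤ |x 0| := by
        by_contra! h
        refine hx fun j _ => ?_
        refine Fin.cases ?_ (fun j => ?_) j
        · exact abs_le.1 h.le
        · exact abs_le.1 (abs_apply_le_of_mem_dotBall hxR _)
      rw [dotProduct_single_one]
      have h1 : 1 ≤ ENNReal.ofReal ((δ : ℝ) ^ p)⁻¹ * ENNReal.ofReal (|x 0| ^ p) := by
        rw [← ENNReal.ofReal_mul (by positivity), ENNReal.one_le_ofReal,
          ← div_eq_inv_mul, one_le_div (by positivity)]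
        exact rpow_le_rpow hδ'.le hδx hp
      calc g x = g x * 1 := (mul_one _).symm
        _ ≤ g x * (ENNReal.ofReal ((δ : ℝ) ^ p)⁻¹ * ENNReal.ofReal (|x 0| ^ p)) := by gcongr
        _ = _ := by ring
  have hle := lintegral_mono (μ := volume) hpt
  rw [hgm, lintegral_add_left (measurable_one.indicator hSm), lintegral_indicator_one hSm,
    lintegral_const_mul _ (measurable_Phi_integrand p hg _)] at hle
  have h2 : m / 2 + m / 2 ≤ m / 2 + ENNReal.ofReal ((δ : ℝ) ^ p)⁻¹ * Phi p g (Pi.single 0 1) := by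
    rw [ENNReal.add_halves]
    exact hle.trans (by unfold Phi; gcongr)
  exact (ENNReal.add_le_add_iff_left (ENNReal.div_ne_top hmt two_ne_zero)).1 h2

/-- Every vector is a reflected multiple of the first basis vector. -/
lemma exists_refl_eq (y : Fin (n + 1) → ℝ) :
    ∃ w, y = refl w (√(y ⬝ᵥ y) • Pi.single 0 1) := by
  refine ⟨√(y ⬝ᵥ y) • Pi.single 0 1 - y, (refl_sub_self ?_).symm⟩
  simp [Real.mul_self_sqrt (dotProduct_self_nonneg' y)]

lemma setOf_Phi_le_one_subset_dotBall (hp : 0 < p) (hm : m ≠ 0) (hmt : m ≠ ∞) :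
    ∃ D : ℝ, ∀ g : (Fin (n + 1) → ℝ) → ℝ≥0∞, Measurable g → (∀ x, g x ≤ 1) →
      BallSupp R g → ∫⁻ x, g x = m → {y | Phi p g y ≤ 1} ⊆ dotBall (n + 1) D := by
  obtain ⟨C, hC, h⟩ := lintegral_half_le_Phi (n := n) (R := R) hp.le hm hmt
  have hm2 : m / 2 ≠ 0 := ENNReal.div_ne_zero.2 ⟨hm, ENNReal.ofNat_ne_top⟩
  have hm2t : m / 2 ≠ ∞ := ENNReal.div_ne_top hmt two_ne_zero
  refine ⟨((C / (m / 2)).toReal ^ p⁻¹) ^ 2, fun g hg hg1 hgR hgm y hy => ?_⟩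
  obtain ⟨w, hw⟩ := exists_refl_eq y
  set r := √(y ⬝ᵥ y) with hr
  have hr0 : 0 ≤ r := Real.sqrt_nonneg _
  have h1 := h (fun x => g (refl w x)) (hg.comp (continuous_refl w).measurable) (fun x => hg1 _)
    (fun x hx => by simpa [refl_dotProduct_refl] using hgR _ hx)
    ((lintegral_comp_refl w hg).trans hgm)
  have h2 : Phi p g y = ENNReal.ofReal (r ^ p) * Phi p (fun x => g (refl w x)) (Pi.single 0 1) := by
    conv_lhs => rw [hw]
    rw [← Phi_comp_refl p hg, Phi_smul p (f := fun x => g (refl w x))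
      (hg.comp (continuous_refl w).measurable),
      abs_of_nonneg hr0]
  have hy : Phi p g y ≤ 1 := hy
  have h3 : ENNReal.ofReal (r ^ p) ≤ C / (m / 2) := by
    rw [ENNReal.le_div_iff_mul_le (Or.inl hm2) (Or.inl hm2t)]
    calc ENNReal.ofReal (r ^ p) * (m / 2)
        ≤ ENNReal.ofReal (r ^ p) * (C * Phi p (fun x => g (refl w x)) (Pi.single 0 1)) := by gcongr
      _ = C * Phi p g y := by rw [h2]; ring
      _ ≤ C * 1 := by gcongr
      _ = C := mul_one C
  have h4 : r ^ p ≤ (C / (m / 2)).toReal :=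
    (ENNReal.ofReal_le_iff_le_toReal (ENNReal.div_ne_top hC hm2)).1 h3
  have h5 : r ≤ (C / (m / 2)).toReal ^ p⁻¹ := by
    rw [← rpow_rpow_inv hr0 hp.ne']
    gcongr
  show y ⬝ᵥ y ≤ _
  rw [← Real.sq_sqrt (dotProduct_self_nonneg' y), ← hr]
  gcongr

lemma le_measure_of_frequently {α : Type*} [MeasurableSpace α] {μ : Measure α} {A : ℕ → Set α}
    {B D : Set α} (hA : ∀ k, MeasurableSet (A k)) (hAD : ∀ k, A k ⊆ D) (hD : μ D ≠ ∞)
    (hAB : ∀ y, (∃ᶠ k in Filter.atTop, y ∈ A k) → y ∈ B) (hv : ∀ k, v ≤ μ (A k)) : v ≤ μ B := by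
  set U : ℕ → Set α := fun N => ⋃ k ≥ N, A k
  have hU : ∀ N, MeasurableSet (U N) := fun N =>
    MeasurableSet.iUnion fun k => MeasurableSet.iUnion fun _ => hA k
  have hanti : Antitone U := fun N M h =>
    iUnion₂_subset fun k hk => subset_iUnion₂_of_subset k (le_trans h hk) le_rfl
  have hlim := tendsto_measure_iInter_atTop (μ := μ) (fun N => (hU N).nullMeasurableSet) hanti
    ⟨0, ne_top_of_le_ne_top hD (measure_mono (iUnion₂_subset fun k _ => hAD k))⟩
  refine (ge_of_tendsto' hlim fun N => (hv N).trans ?_).trans (measure_mono fun y hy => hAB y ?_)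
  · exact measure_mono (subset_iUnion₂_of_subset N le_rfl le_rfl)
  · rw [Filter.frequently_atTop]
    intro N
    simpa [U] using mem_iInter.1 hy N

lemma exists_moment_minimizer (hp : 1 ≤ p) (hm : m ≠ 0) (hmt : m ≠ ∞)
    (hne : ∃ g : (Fin (n + 1) → ℝ) → ℝ≥0∞, Adm p R m v g) :
    ∃ G : (Fin (n + 1) → ℝ) → ℝ≥0∞, Adm p R m v G ∧
      ∀ g : (Fin (n + 1) → ℝ) → ℝ≥0∞, Adm p R m v g → moment G ≤ moment g := by
  obtain ⟨g₀, hg₀⟩ := hne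
  obtain ⟨u, -, hu, huS⟩ := exists_seq_tendsto_sInf
    (S := moment '' {g : (Fin (n + 1) → ℝ) → ℝ≥0∞ | Adm p R m v g}) ⟨_, g₀, hg₀, rfl⟩
    (OrderBot.bddBelow _)
  choose g hg hgu using huS
  have hg : ∀ k, Adm p R m v (g k) := hg
  have hK := isCompact_dotBall (n + 1) R
  set K := dotBall (n + 1) R
  have : IsFiniteMeasure (volume.restrict K) := ⟨by
    rw [Measure.restrict_apply_univ]; exact hK.measure_lt_top⟩
  obtain ⟨G₀, hG₀, hG₀1, φ, hφ, hlim⟩ := exists_weak_limit (μ := volume.restrict K)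
    (fun k => (hg k).meas) (fun k => (hg k).le_one)
  have hsupp : ∀ {F : (Fin (n + 1) → ℝ) → ℝ≥0∞}, BallSupp R F → ∀ H : (Fin (n + 1) → ℝ) → ℝ,
      ∫⁻ x in K, F x * ENNReal.ofReal (K.indicator H x) = ∫⁻ x, F x * ENNReal.ofReal (H x) := by
    intro F hF H
    rw [← lintegral_indicator hK.measurableSet]
    refine lintegral_congr fun x => ?_
    by_cases hx : x ∈ K
    · simp [hx]
    · have : F x = 0 := by
        by_contra h
        exact hx (hF x h)
      simp [hx, this]
  have hGR : BallSupp R (K.indicator G₀) := fun x hx => by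
    by_contra h
    exact hx (indicator_of_notMem (s := K) h G₀)
  have hG : Measurable (K.indicator G₀) := hG₀.indicator hK.measurableSet
  have hlim' : ∀ H : (Fin (n + 1) → ℝ) → ℝ, Continuous H → (∀ x, 0 ≤ H x) →
      Filter.Tendsto (fun k => ∫⁻ x, g (φ k) x * ENNReal.ofReal (H x)) Filter.atTop
        (nhds (∫⁻ x, K.indicator G₀ x * ENNReal.ofReal (H x))) := by
    intro H hH hH0
    obtain ⟨C, hC⟩ := hK.bddAbove_image hH.continuousOn
    have h1 := hlim (K.indicator H) (hH.measurable.indicator hK.measurableSet)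
      (indicator_nonneg fun x _ => hH0 x) (max C 0) fun x => by
        by_cases hx : x ∈ K
        · rw [indicator_of_mem hx]
          exact (hC ⟨x, hx, rfl⟩).trans (le_max_left _ _)
        · rw [indicator_of_notMem hx]
          exact le_max_right _ _
    simp_rw [hsupp (hg _).supp] at h1
    rw [← hsupp hGR]
    convert h1 using 2
    refine setLIntegral_congr_fun hK.measurableSet fun x hx => ?_
    simp only [indicator_of_mem hx]
  have hmomG : moment (K.indicator G₀) =
      sInf (moment '' {g : (Fin (n + 1) → ℝ) → ℝ≥0∞ | Adm p R m v g}) := by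
    refine tendsto_nhds_unique (hlim' _ continuous_dotProduct_self dotProduct_self_nonneg') ?_
    have := hu.comp hφ.tendsto_atTop
    simp only [Function.comp_def, ← hgu] at this
    exact this
  refine ⟨K.indicator G₀, ⟨hG, fun x => (indicator_le_self _ _ x).trans (hG₀1 x), hGR, ?_, ?_⟩,
    fun g hg => hmomG ▸ sInf_le ⟨g, hg, rfl⟩⟩
  · have := hlim' (fun _ => 1) continuous_const fun _ => zero_le_one
    simp only [ENNReal.ofReal_one, mul_one, (hg _).mass] at this
    exact tendsto_nhds_unique this tendsto_const_nhds
  · obtain ⟨D, hD⟩ := setOf_Phi_le_one_subset_dotBall (n := n) (R := R) (by linarith) hm hmt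
    refine le_measure_of_frequently (A := fun k => {y | Phi p (g (φ k)) y ≤ 1})
      (fun k => measurableSet_le (measurable_Phi p (hg _).meas) measurable_const)
      (fun k => hD _ (hg _).meas (hg _).le_one (hg _).supp (hg _).mass)
      (isCompact_dotBall _ D).measure_ne_top (fun y hy => ?_) (fun k => (hg _).vol)
    refine le_of_tendsto_of_frequently (hlim' (fun x => |x ⬝ᵥ y| ^ p) ?_ ?_) hy
    · exact (continuous_dotProduct_left y).abs.rpow_const fun x => Or.inr (by linarith)
    · exact fun x => by positivity

end Minimizer

section Ball

variable {n : ℕ} {p R : ℝ} {m v : ℝ≥0∞} {g : (Fin (n + 1) → ℝ) → ℝ≥0∞}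

lemma Adm.Phi_eq_of_minimizer (hp : 1 ≤ p) (hg : Adm p R m v g)
    (hmin : ∀ f : (Fin (n + 1) → ℝ) → ℝ≥0∞, Adm p R m v f → moment g ≤ moment f)
    {a b : Fin (n + 1) → ℝ} (hab : a ⬝ᵥ a = b ⬝ᵥ b) : Phi p g a = Phi p g b := by
  have h1 : ∀ w z : Fin (n + 1) → ℝ,
      Phi p g (refl w (refl (Pi.single 0 1) z)) = Phi p g (refl w z) := by
    intro w z
    have hw := hg.comp_refl w
    have hae := steiner_ae_eq_of_moment_le 0 hw.meas hw.le_one hw.supp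
      ((moment_comp_refl hg.meas w).trans_le (hmin _ (hw.steiner hp 0)))
    have h2 : ∀ z, Phi p (fun x => g (refl w x)) z =
        Phi p (LpSantalo.steiner 0 fun x => g (refl w x)) z := fun z =>
      lintegral_congr_ae (hae.mono fun x hx => by simp only [hx])
    rw [← Phi_comp_refl p hg.meas, ← Phi_comp_refl p hg.meas, h2, h2,
      ← Phi_comp_refl p (measurable_steiner 0 hw.meas)]
    simp_rw [refl_single_zero, steiner_update_neg]
  rcases eq_or_ne a b with rfl | hne
  · rfl
  set d := a - b
  have hd : 0 < d ⬝ᵥ d := lt_of_le_of_ne (dotProduct_self_nonneg' d) fun h =>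
    hne (sub_eq_zero.1 (dotProduct_self_eq_zero.1 h.symm))
  set u := (√(d ⬝ᵥ d))⁻¹ • d
  have hu : (Pi.single 0 1 : Fin (n + 1) → ℝ) ⬝ᵥ Pi.single 0 1 = u ⬝ᵥ u := by
    simp only [u, smul_dotProduct, dotProduct_smul, smul_eq_mul, dotProduct_single_one,
      Pi.single_eq_same]
    rw [← mul_assoc, ← mul_inv, Real.mul_self_sqrt hd.le, inv_mul_cancel₀ hd.ne']
  have h3 := h1 (Pi.single 0 1 - u) (refl (Pi.single 0 1 - u) a)
  rw [refl_conj, refl_refl, refl_sub_self hu,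
    refl_smul (inv_ne_zero (Real.sqrt_pos.2 hd).ne'), refl_sub_self hab] at h3
  exact h3.symm

/-- The Euclidean norm of a vector. -/
noncomputable def eNorm {n : ℕ} (x : Fin n → ℝ) : ℝ := √(x ⬝ᵥ x)

lemma eNorm_nonneg {n : ℕ} (x : Fin n → ℝ) : 0 ≤ eNorm x := Real.sqrt_nonneg _

lemma continuous_eNorm {n : ℕ} : Continuous (eNorm (n := n)) :=
  continuous_dotProduct_self.sqrt

lemma Phi_eq_of_forall (hg : Measurable g)
    (h : ∀ {a b : Fin (n + 1) → ℝ}, a ⬝ᵥ a = b ⬝ᵥ b → Phi p g a = Phi p g b)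
    (y : Fin (n + 1) → ℝ) :
    Phi p g y = ENNReal.ofReal (eNorm y ^ p) * Phi p g (Pi.single 0 1) := by
  rw [h (b := eNorm y • Pi.single 0 1), Phi_smul p hg, abs_of_nonneg (eNorm_nonneg y)]
  simp [eNorm, Real.mul_self_sqrt (dotProduct_self_nonneg' y)]

lemma measurableSet_dotBall (n : ℕ) (s : ℝ) : MeasurableSet (dotBall n s) :=
  (isCompact_dotBall n s).measurableSet

lemma measurable_indicator_dotBall (n : ℕ) (s : ℝ) :
    Measurable ((dotBall n s).indicator (1 : (Fin n → ℝ) → ℝ≥0∞)) :=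
  measurable_one.indicator (measurableSet_dotBall n s)

lemma Phi_indicator_dotBall_eq (p s : ℝ) {a b : Fin n → ℝ} (hab : a ⬝ᵥ a = b ⬝ᵥ b) :
    Phi p ((dotBall n s).indicator 1) a = Phi p ((dotBall n s).indicator 1) b := by
  rw [← refl_sub_self hab, ← Phi_comp_refl p (measurable_indicator_dotBall n s)]
  have : ∀ x, refl (a - b) x ∈ dotBall n s ↔ x ∈ dotBall n s := fun x => by
    simp only [dotBall, mem_ofPred_eq, refl_dotProduct_refl]
  congr 1
  ext x
  by_cases hx : x ∈ dotBall n s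
  · rw [indicator_of_mem hx, indicator_of_mem ((this x).2 hx)]; rfl
  · rw [indicator_of_notMem hx, indicator_of_notMem (mt (this x).1 hx)]

lemma lintegral_mul_Phi_comm {f g : (Fin n → ℝ) → ℝ≥0∞} (hf : Measurable f) (hg : Measurable g) :
    ∫⁻ y, f y * Phi p g y = ∫⁻ x, g x * Phi p f x := by
  have hd := measurable_dotProduct (n := n)
  calc ∫⁻ y, f y * Phi p g y
      = ∫⁻ y, ∫⁻ x, f y * (g x * ENNReal.ofReal (|x ⬝ᵥ y| ^ p)) :=
        lintegral_congr fun y => (lintegral_const_mul _ (measurable_Phi_integrand p hg y)).symm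
    _ = ∫⁻ x, ∫⁻ y, f y * (g x * ENNReal.ofReal (|x ⬝ᵥ y| ^ p)) := by
        refine lintegral_lintegral_swap (Measurable.aemeasurable ?_)
        have h2 : Measurable fun q : (Fin n → ℝ) × (Fin n → ℝ) => q.2 ⬝ᵥ q.1 :=
          hd.comp measurable_swap
        unfold Function.uncurry
        fun_prop
    _ = ∫⁻ x, g x * Phi p f x := by
        refine lintegral_congr fun x => ?_
        rw [Phi, ← lintegral_const_mul _ (measurable_Phi_integrand p hf x)]
        refine lintegral_congr fun y => ?_
        rw [dotProduct_comm y x]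
        ring

lemma ballSupp_indicator_dotBall (n : ℕ) (s : ℝ) :
    BallSupp s ((dotBall n s).indicator (1 : (Fin n → ℝ) → ℝ≥0∞)) := fun x hx => by
  by_contra h
  exact hx (indicator_of_notMem (s := dotBall n s) h _)

lemma lintegral_dotBall_le (hp : 0 ≤ p) {s : ℝ} (hg : Measurable g) (hg1 : ∀ x, g x ≤ 1)
    (hgm : ∫⁻ x, g x = volume (dotBall (n + 1) s)) :
    ∫⁻ x, (dotBall (n + 1) s).indicator 1 x * ENNReal.ofReal (eNorm x ^ p) ≤
      ∫⁻ x, g x * ENNReal.ofReal (eNorm x ^ p) := by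
  have hB := measurableSet_dotBall (n + 1) s
  have hχ := measurable_indicator_dotBall (n + 1) s
  have ha : Measurable fun x : Fin (n + 1) → ℝ => ENNReal.ofReal (eNorm x ^ p) := by
    have := (continuous_eNorm (n := n + 1)).measurable
    fun_prop
  set l := ENNReal.ofReal (√s ^ p)
  have hpt : ∀ x, (dotBall (n + 1) s).indicator 1 x * ENNReal.ofReal (eNorm x ^ p) + g x * l ≤
      g x * ENNReal.ofReal (eNorm x ^ p) + (dotBall (n + 1) s).indicator 1 x * l := by
    intro x
    by_cases hx : x ∈ dotBall (n + 1) s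
    · rw [indicator_of_mem hx, Pi.one_apply, one_mul, one_mul]
      refine bathtub_le (hg1 x) (ENNReal.ofReal_le_ofReal ?_)
      exact rpow_le_rpow (eNorm_nonneg x) (Real.sqrt_le_sqrt hx) hp
    · rw [indicator_of_notMem hx, zero_mul, zero_mul, zero_add, add_zero]
      gcongr
      exact ENNReal.ofReal_le_ofReal (rpow_le_rpow (Real.sqrt_nonneg _)
        (Real.sqrt_le_sqrt (not_le.1 hx).le) hp)
  have hle := lintegral_mono (μ := volume) hpt
  rw [lintegral_add_right _ (hg.mul_const _), lintegral_add_right _ (hχ.mul_const _),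
    lintegral_mul_const _ hg, lintegral_mul_const _ hχ, lintegral_indicator_one hB, hgm] at hle
  exact (ENNReal.add_le_add_iff_right (ENNReal.mul_ne_top
    (isCompact_dotBall _ _).measure_ne_top ENNReal.ofReal_ne_top)).1 hle

lemma volume_Phi_le_one_le_dotBall (hp : 1 ≤ p) {s : ℝ} (hg : Measurable g) (hg1 : ∀ x, g x ≤ 1)
    (hR : BallSupp R g) (hgm : ∫⁻ x, g x = volume (dotBall (n + 1) s))
    (hm : volume (dotBall (n + 1) s) ≠ 0) :
    volume {y | Phi p g y ≤ 1} ≤ volume {y | Phi p ((dotBall (n + 1) s).indicator 1) y ≤ 1} := by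
  obtain ⟨G, hG, hmin⟩ := exists_moment_minimizer hp hm (isCompact_dotBall _ s).measure_ne_top
    ⟨g, ⟨hg, hg1, hR, hgm, le_refl (volume {y | Phi p g y ≤ 1})⟩⟩
  refine hG.vol.trans (measure_mono fun y hy => ?_)
  have hχ := measurable_indicator_dotBall (n + 1) s
  set χ : (Fin (n + 1) → ℝ) → ℝ≥0∞ := (dotBall (n + 1) s).indicator 1
  have ha : Measurable fun x : Fin (n + 1) → ℝ => ENNReal.ofReal (eNorm x ^ p) := by
    have := (continuous_eNorm (n := n + 1)).measurable
    fun_prop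
  have hma : ∀ {F : (Fin (n + 1) → ℝ) → ℝ≥0∞}, Measurable F →
      Measurable fun x => F x * ENNReal.ofReal (eNorm x ^ p) := fun hF => hF.mul ha
  have hPG := Phi_eq_of_forall hG.meas fun h => hG.Phi_eq_of_minimizer hp hmin h
  have hPχ := Phi_eq_of_forall (p := p) hχ fun h => Phi_indicator_dotBall_eq p s h
  set I := ∫⁻ x, χ x * ENNReal.ofReal (eNorm x ^ p)
  have hI0 : I ≠ 0 := by
    intro h
    rw [lintegral_eq_zero_iff (hma hχ)] at h
    refine hm (measure_mono_null (t := {0} ∪ {x | χ x * ENNReal.ofReal (eNorm x ^ p) ≠ 0})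
      (fun x hx => ?_) (measure_union_null ?_ (ae_iff.1 h)))
    · rcases eq_or_ne x 0 with rfl | h0
      · exact Or.inl rfl
      · refine Or.inr ?_
        have h1 : 0 < eNorm x := Real.sqrt_pos.2 (lt_of_le_of_ne (dotProduct_self_nonneg' x)
          fun h => h0 (dotProduct_self_eq_zero.1 h.symm))
        have h2 : χ x = 1 := indicator_of_mem hx _
        simp only [mem_ofPred_eq, h2, one_mul, ne_eq, ENNReal.ofReal_eq_zero, not_le]
        positivity
    · exact measure_singleton 0
  have hIt : I ≠ ∞ := lintegral_mul_ofReal_ne_top (R := s) (fun x => indicator_le_self' (by simp) x)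
    (ballSupp_indicator_dotBall _ s) (C := ENNReal.ofReal (√s ^ p)) ENNReal.ofReal_ne_top
    fun x hx => ENNReal.ofReal_le_ofReal
      (rpow_le_rpow (eNorm_nonneg x) (Real.sqrt_le_sqrt hx) (by linarith))
  have hcomm := lintegral_mul_Phi_comm (p := p) hχ hG.meas
  have e1 : ∀ x, χ x * Phi p G x =
      χ x * ENNReal.ofReal (eNorm x ^ p) * Phi p G (Pi.single 0 1) := fun x => by
    rw [hPG x, mul_assoc]
  have e2 : ∀ x, G x * Phi p χ x =
      G x * ENNReal.ofReal (eNorm x ^ p) * Phi p χ (Pi.single 0 1) := fun x => by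
    rw [hPχ x, mul_assoc]
  rw [lintegral_congr e1, lintegral_congr e2] at hcomm
  rw [lintegral_mul_const _ (hma hχ), lintegral_mul_const _ (hma hG.meas)] at hcomm
  have hbath := lintegral_dotBall_le (p := p) (by linarith) hG.meas hG.le_one hG.mass
  have hC : Phi p χ (Pi.single 0 1) ≤ Phi p G (Pi.single 0 1) := by
    rw [← ENNReal.mul_le_mul_iff_right hI0 hIt, hcomm]
    gcongr
  have hy : Phi p G y ≤ 1 := hy
  refine le_trans (b := Phi p G y) ?_ hy
  rw [hPG, hPχ]
  gcongr

end Ball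

section Constants

variable {n : ℕ} {p R : ℝ}

lemma lintegral_comp_smul {F : (Fin n → ℝ) → ℝ≥0∞} (hF : Measurable F) {r : ℝ} (hr : 0 < r) :
    ∫⁻ x, F x = ENNReal.ofReal (r ^ n) * ∫⁻ x, F (r • x) := by
  rw [← lintegral_map hF (measurable_const_smul r), Measure.map_addHaar_smul _ hr.ne',
    lintegral_smul_measure, smul_eq_mul, ← mul_assoc, Module.finrank_fin_fun,
    abs_of_pos (by positivity), ← ENNReal.ofReal_mul (by positivity),
    mul_inv_cancel₀ (by positivity), ENNReal.ofReal_one, one_mul]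

lemma norm_toLp_sq (x : Fin n → ℝ) : ‖WithLp.toLp 2 x‖ ^ 2 = x ⬝ᵥ x := by
  rw [EuclideanSpace.real_norm_sq_eq, dotProduct]
  exact Finset.sum_congr rfl fun i _ => sq _

/-- The volume of the Euclidean unit ball. -/
noncomputable def ballVol (n : ℕ) : ℝ := √π ^ n / Gamma ((n : ℝ) / 2 + 1)

lemma ballVol_pos (n : ℕ) : 0 < ballVol n :=
  div_pos (by positivity) (Gamma_pos_of_pos (by positivity))

lemma volume_dotBall {r : ℝ} (hr : 0 ≤ r) :
    volume (dotBall (n + 1) (r ^ 2)) = ENNReal.ofReal (r ^ (n + 1) * ballVol (n + 1)) := by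
  have h : dotBall (n + 1) (r ^ 2) =
      WithLp.toLp 2 ⁻¹' Metric.closedBall (0 : EuclideanSpace ℝ (Fin (n + 1))) r := by
    ext x
    rw [mem_preimage, mem_closedBall_zero_iff, ← sq_le_sq₀ (norm_nonneg _) hr, norm_toLp_sq]
    rfl
  rw [h, (PiLp.volume_preserving_toLp _).measure_preimage
    Metric.isClosed_closedBall.measurableSet.nullMeasurableSet]
  rw [EuclideanSpace.volume_closedBall, ballVol, Fintype.card_fin,
    ENNReal.ofReal_mul (by positivity), ENNReal.ofReal_pow hr]

lemma lintegral_ofReal_of_integral_pos {α : Type*} [MeasurableSpace α] {μ : Measure α} {F : α → ℝ}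
    (hF : ∀ x, 0 ≤ F x) {I : ℝ} (hI : ∫ x, F x ∂μ = I) (h0 : I ≠ 0) :
    ∫⁻ x, ENNReal.ofReal (F x) ∂μ = ENNReal.ofReal I := by
  rw [← hI, ofReal_integral_eq_lintegral_ofReal (Integrable.of_integral_ne_zero (hI ▸ h0))
    (.of_forall hF)]

lemma lintegral_exp_neg_sq_mul (hp : 0 ≤ p) :
    ∫⁻ s : ℝ, ENNReal.ofReal (exp (-s ^ 2) * |s| ^ p) = ENNReal.ofReal (Gamma ((p + 1) / 2)) := by
  refine lintegral_ofReal_of_integral_pos (fun s => by positivity) ?_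
    (Gamma_pos_of_pos (by positivity)).ne'
  have h1 := integral_comp_abs (f := fun s => exp (-s ^ 2) * s ^ p)
  simp only [sq_abs] at h1
  rw [h1]
  have h2 := integral_rpow_mul_exp_neg_rpow (p := 2) (q := p) two_pos (by linarith)
  rw [show (2 : ℝ) * ∫ x in Ioi (0 : ℝ), exp (-x ^ 2) * x ^ p =
    2 * ∫ x in Ioi (0 : ℝ), x ^ p * exp (-x ^ (2 : ℝ)) by simp [mul_comm], h2]
  ring

lemma lintegral_exp_neg_dotProduct (n : ℕ) :
    ∫⁻ x : Fin n → ℝ, ENNReal.ofReal (exp (-(x ⬝ᵥ x))) = ENNReal.ofReal (√π ^ n) := by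
  induction n with
  | zero => simp [volume_pi]
  | succ n ih =>
    have hm : ∀ n, Measurable fun x : Fin n → ℝ => ENNReal.ofReal (exp (-(x ⬝ᵥ x))) := fun n => by
      have := (continuous_dotProduct_self (n := n)).measurable
      fun_prop
    have h1 := lintegral_exp_neg_sq_mul (p := 0) le_rfl
    simp only [rpow_zero, mul_one, zero_add, Gamma_one_half_eq] at h1
    rw [lintegral_ins 0 (hm _)]
    simp_rw [ins_dotProduct, neg_add, exp_add, ENNReal.ofReal_mul (exp_pos _).le]
    simp_rw [lintegral_const_mul _ (hm n), ih]
    rw [lintegral_mul_const _ (by fun_prop)]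
    simp_rw [← sq, h1]
    rw [← ENNReal.ofReal_mul (by positivity), pow_succ']

lemma lintegral_exp_neg_dotProduct_mul (hp : 0 ≤ p) :
    ∫⁻ x : Fin (n + 1) → ℝ, ENNReal.ofReal (exp (-(x ⬝ᵥ x))) * ENNReal.ofReal (|x 0| ^ p) =
      ENNReal.ofReal (Gamma ((p + 1) / 2) * √π ^ n) := by
  have hm : ∀ n, Measurable fun x : Fin n → ℝ => ENNReal.ofReal (exp (-(x ⬝ᵥ x))) := fun n => by
    have := (continuous_dotProduct_self (n := n)).measurable
    fun_prop
  have hF : Measurable fun x : Fin (n + 1) → ℝ =>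
      ENNReal.ofReal (exp (-(x ⬝ᵥ x))) * ENNReal.ofReal (|x 0| ^ p) := (hm _).mul (by fun_prop)
  rw [lintegral_ins 0 hF]
  have e : ∀ (s : ℝ) (x : Fin n → ℝ), ENNReal.ofReal (exp (-(ins 0 s x ⬝ᵥ ins 0 s x))) *
      ENNReal.ofReal (|ins 0 s x 0| ^ p) =
      ENNReal.ofReal (exp (-s ^ 2) * |s| ^ p) * ENNReal.ofReal (exp (-(x ⬝ᵥ x))) := by
    intro s x
    rw [ins_same, ins_dotProduct, ← ENNReal.ofReal_mul (by positivity),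
      ← ENNReal.ofReal_mul (by positivity), neg_add, exp_add]
    ring_nf
  simp_rw [e, lintegral_const_mul _ (hm n), lintegral_exp_neg_dotProduct]
  rw [lintegral_mul_const _ (by fun_prop), lintegral_exp_neg_sq_mul hp,
    ← ENNReal.ofReal_mul (Gamma_pos_of_pos (by positivity)).le]

lemma Phi_dotBall {s : ℝ} (hs : 0 < s) (y : Fin n → ℝ) :
    Phi p ((dotBall n s).indicator 1) y =
      ENNReal.ofReal (s ^ (((n : ℝ) + p) / 2)) * Phi p ((dotBall n 1).indicator 1) y := by
  have hs' : 0 < √s := Real.sqrt_pos.2 hs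
  have h1 : ∀ x : Fin n → ℝ, (dotBall n s).indicator (1 : (Fin n → ℝ) → ℝ≥0∞) (√s • x) =
      (dotBall n 1).indicator 1 x := by
    intro x
    have : √s • x ∈ dotBall n s ↔ x ∈ dotBall n 1 := by
      simp only [dotBall, mem_ofPred_eq, smul_dotProduct, dotProduct_smul, smul_eq_mul]
      rw [← mul_assoc, Real.mul_self_sqrt hs.le]
      exact ⟨fun h => by nlinarith, fun h => by nlinarith⟩
    by_cases hx : x ∈ dotBall n 1
    · rw [indicator_of_mem hx, indicator_of_mem (this.2 hx)]; rfl
    · rw [indicator_of_notMem hx, indicator_of_notMem (mt this.1 hx)]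
  have h2 : (s : ℝ) ^ (((n : ℝ) + p) / 2) = √s ^ n * √s ^ p := by
    rw [Real.sqrt_eq_rpow, ← rpow_natCast, ← rpow_mul hs.le, ← rpow_mul hs.le, ← rpow_add hs]
    ring_nf
  rw [Phi, lintegral_comp_smul
    (measurable_Phi_integrand p (measurable_indicator_dotBall n s) y) hs', Phi, h2,
    ENNReal.ofReal_mul (by positivity), mul_assoc,
    ← lintegral_const_mul _ (measurable_Phi_integrand p (measurable_indicator_dotBall n 1) y)]
  congr 1
  refine lintegral_congr fun x => ?_
  rw [h1, smul_dotProduct, smul_eq_mul, abs_mul, mul_rpow (abs_nonneg _) (abs_nonneg _),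
    abs_of_pos hs', ENNReal.ofReal_mul (by positivity)]
  ring

lemma lintegral_Ioi_exp_neg (q : ℝ) :
    ∫⁻ s in Ioi q, ENNReal.ofReal (exp (-s)) = ENNReal.ofReal (exp (-q)) :=
  lintegral_ofReal_of_integral_pos (fun _ => (exp_pos _).le) (integral_exp_neg_Ioi q)
    (exp_pos _).ne'

/-- The `p`-th moment of a coordinate over the Euclidean unit ball. -/
noncomputable def ballMoment (n : ℕ) (p : ℝ) : ℝ :=
  Gamma ((p + 1) / 2) * √π ^ ((n : ℝ) - 1) / Gamma (((n : ℝ) + p) / 2 + 1)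

lemma ballMoment_pos (n : ℕ) (hp : 0 ≤ p) : 0 < ballMoment n p :=
  div_pos (mul_pos (Gamma_pos_of_pos (by positivity)) (by positivity))
    (Gamma_pos_of_pos (by positivity))

lemma Phi_unitBall (hp : 0 ≤ p) :
    Phi p ((dotBall (n + 1) 1).indicator 1) (Pi.single 0 1) =
      ENNReal.ofReal (ballMoment (n + 1) p) := by
  set c := Phi p ((dotBall (n + 1) 1).indicator 1) (Pi.single 0 1) with hc
  set γ := (((n + 1 : ℕ) : ℝ) + p) / 2 with hγ
  have hγ0 : 0 ≤ γ := by positivity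
  have hΓ : 0 < Gamma (γ + 1) := Gamma_pos_of_pos (by positivity)
  have hlhs : ∫⁻ x : Fin (n + 1) → ℝ, ENNReal.ofReal (exp (-(x ⬝ᵥ x))) *
      ENNReal.ofReal (|x 0| ^ p) = ENNReal.ofReal (Gamma (γ + 1)) * c := by
    have hmeas : Measurable fun q : (Fin (n + 1) → ℝ) × ℝ =>
        (Ici (q.1 ⬝ᵥ q.1)).indicator (fun s => ENNReal.ofReal (exp (-s))) q.2 *
          ENNReal.ofReal (|q.1 0| ^ p) := by
      have hd : Measurable fun q : (Fin (n + 1) → ℝ) × ℝ => q.1 ⬝ᵥ q.1 :=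
        continuous_dotProduct_self.measurable.comp measurable_fst
      have hS : MeasurableSet {q : (Fin (n + 1) → ℝ) × ℝ | q.1 ⬝ᵥ q.1 ≤ q.2} :=
        measurableSet_le hd measurable_snd
      have h0 : Measurable fun q : (Fin (n + 1) → ℝ) × ℝ => q.1 0 := by fun_prop
      exact ((show Measurable fun q : (Fin (n + 1) → ℝ) × ℝ =>
        ENNReal.ofReal (exp (-q.2)) by fun_prop).indicator hS).mul (by fun_prop)
    calc ∫⁻ x : Fin (n + 1) → ℝ, ENNReal.ofReal (exp (-(x ⬝ᵥ x))) * ENNReal.ofReal (|x 0| ^ p)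
        = ∫⁻ x : Fin (n + 1) → ℝ, ∫⁻ s : ℝ,
            (Ici (x ⬝ᵥ x)).indicator (fun s => ENNReal.ofReal (exp (-s))) s *
              ENNReal.ofReal (|x 0| ^ p) := by
          refine lintegral_congr fun x => ?_
          rw [lintegral_mul_const _ ((by fun_prop : Measurable fun s : ℝ =>
            ENNReal.ofReal (exp (-s))).indicator measurableSet_Ici),
            lintegral_indicator measurableSet_Ici,
            setLIntegral_congr Ioi_ae_eq_Ici.symm, lintegral_Ioi_exp_neg]
      _ = ∫⁻ s : ℝ, ∫⁻ x : Fin (n + 1) → ℝ,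
            (Ici (x ⬝ᵥ x)).indicator (fun s => ENNReal.ofReal (exp (-s))) s *
              ENNReal.ofReal (|x 0| ^ p) := lintegral_lintegral_swap hmeas.aemeasurable
      _ = ∫⁻ s : ℝ, (Ioi (0 : ℝ)).indicator
            (fun s => ENNReal.ofReal (exp (-s) * s ^ γ) * c) s := by
          refine lintegral_congr_ae ?_
          filter_upwards [compl_mem_ae_iff.2 (measure_singleton (0 : ℝ))] with s hs
          rcases lt_or_gt_of_ne (show s ≠ 0 from hs) with h | h
          · rw [indicator_of_notMem (by simpa using h.le)]
            refine (lintegral_congr fun x => ?_).trans lintegral_zero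
            have := dotProduct_self_nonneg' x
            rw [indicator_of_notMem (by simp only [mem_Ici]; linarith), zero_mul]
          · rw [indicator_of_mem (mem_Ioi.2 h), ENNReal.ofReal_mul (exp_pos _).le, mul_assoc, hc,
              ← Phi_dotBall h, Phi, ← lintegral_const_mul _
                (measurable_Phi_integrand p (measurable_indicator_dotBall _ s) _)]
            refine lintegral_congr fun x => ?_
            have hx : x ⬝ᵥ Pi.single 0 1 = x 0 := by simp
            rw [hx, ← mul_assoc]
            congr 1
            by_cases hxs : x ⬝ᵥ x ≤ s
            · rw [indicator_of_mem (by exact hxs), indicator_of_mem (by exact hxs)]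
              simp
            · rw [indicator_of_notMem (by exact hxs), indicator_of_notMem (by exact hxs), mul_zero]
      _ = ENNReal.ofReal (Gamma (γ + 1)) * c := by
          rw [lintegral_indicator measurableSet_Ioi, lintegral_mul_const _ (by fun_prop)]
          congr 1
          have hI := Gamma_eq_integral (s := γ + 1) (by positivity)
          simp only [add_sub_cancel_right] at hI
          rw [hI, ofReal_integral_eq_lintegral_ofReal
            (Integrable.of_integral_ne_zero (hI ▸ hΓ.ne'))]
          filter_upwards [ae_restrict_mem measurableSet_Ioi] with s hs
          have : 0 < s := hs
          positivity
  rw [lintegral_exp_neg_dotProduct_mul hp] at hlhs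
  rw [ballMoment, ENNReal.ofReal_div_of_pos (by rw [← hγ]; exact hΓ), ← hγ,
    ENNReal.eq_div_iff (by simpa using hΓ) ENNReal.ofReal_ne_top, ← hlhs]
  simp

lemma ballVol_sq_mul (n : ℕ) (hp : 0 < p) :
    ballVol n ^ 2 * (ballVol n / ballMoment n p) ^ ((n : ℝ) / p) =
      Rnp n p * 2 ^ (-(n : ℝ) / p) := by
  have hG : 0 < Gamma ((n : ℝ) / 2 + 1) := Gamma_pos_of_pos (by positivity)
  have hG2 : 0 < Gamma (((n : ℝ) + p) / 2 + 1) := Gamma_pos_of_pos (by positivity)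
  have hG3 : 0 < Gamma ((p + 1) / 2) := Gamma_pos_of_pos (by positivity)
  have hpi : 0 < √π := Real.sqrt_pos.2 pi_pos
  have e1 : ballVol n / ballMoment n p = √π * (Gamma (((n : ℝ) + p) / 2 + 1) /
      (Gamma ((n : ℝ) / 2 + 1) * Gamma ((p + 1) / 2))) := by
    rw [ballVol, ballMoment, rpow_sub hpi, rpow_natCast, rpow_one]
    field_simp
  rw [e1, mul_rpow hpi.le (by positivity), Rnp, show ((n : ℝ) + 2) / 2 = (n : ℝ) / 2 + 1 by ring,
    show ((n : ℝ) + p + 2) / 2 = ((n : ℝ) + p) / 2 + 1 by ring, mul_div_assoc 2,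
    mul_rpow two_pos.le (by positivity), ballVol, rpow_add pi_pos, Real.sqrt_eq_rpow,
    ← rpow_mul pi_pos.le, neg_div, rpow_neg two_pos.le, div_pow, ← pow_mul, rpow_natCast,
    ← rpow_natCast, ← rpow_mul pi_pos.le]
  have h2 : (2 : ℝ) ^ ((n : ℝ) / p) ≠ 0 := by positivity
  have e2 : 1 / 2 * ((n * 2 : ℕ) : ℝ) = n := by push_cast; ring
  have e3 : 1 / 2 * ((n : ℝ) / p) = n / (2 * p) := by field_simp
  rw [e2, e3, rpow_natCast]
  field_simp

theorem volume_Phi_le_one_le (hp : 1 ≤ p) {g : (Fin (n + 1) → ℝ) → ℝ≥0∞} (hg : Measurable g)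
    (hg1 : ∀ x, g x ≤ 1) (hR : BallSupp R g) {m : ℝ} (hm : 0 < m)
    (hgm : ∫⁻ x, g x = ENNReal.ofReal m) :
    volume {y | Phi p g y ≤ 1} ≤ ENNReal.ofReal (Rnp (n + 1) p *
      2 ^ (-((n + 1 : ℕ) : ℝ) / p) * m ^ (-(((n + 1 : ℕ) : ℝ) + p) / p)) := by
  have hp0 : 0 < p := by linarith
  set N : ℝ := ((n + 1 : ℕ) : ℝ) with hN
  have hN0 : 0 < N := by positivity
  set w := ballVol (n + 1) with hw
  have hw0 : 0 < w := ballVol_pos _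
  set c := ballMoment (n + 1) p with hc
  have hc0 : 0 < c := ballMoment_pos _ hp0.le
  set r := (m / w) ^ (1 / N) with hr
  have hr0 : 0 < r := by positivity
  have hvol : volume (dotBall (n + 1) (r ^ 2)) = ENNReal.ofReal m := by
    rw [volume_dotBall hr0.le, ← hw, ← rpow_natCast, ← hN, hr, ← rpow_mul (by positivity),
      one_div_mul_cancel hN0.ne', rpow_one, div_mul_cancel₀ _ hw0.ne']
  refine (volume_Phi_le_one_le_dotBall hp hg hg1 hR (hgm.trans hvol.symm)
    (by rw [hvol]; simpa using hm)).trans ?_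
  set d := r ^ (N + p) * c with hd
  have hd0 : 0 < d := by positivity
  set t := d ^ (-(1 / p)) with ht
  have ht0 : 0 < t := by positivity
  have hball : Phi p ((dotBall (n + 1) (r ^ 2)).indicator 1) (Pi.single 0 1) =
      ENNReal.ofReal d := by
    rw [Phi_dotBall (by positivity), Phi_unitBall hp0.le, ← ENNReal.ofReal_mul (by positivity),
      ← rpow_natCast, ← rpow_mul hr0.le, hd, ← hN]
    congr 3
    push_cast
    ring
  have hset : {y | Phi p ((dotBall (n + 1) (r ^ 2)).indicator 1) y ≤ 1} =
      dotBall (n + 1) (t ^ 2) := by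
    ext y
    rw [mem_ofPred_eq, Phi_eq_of_forall (measurable_indicator_dotBall _ _)
      (Phi_indicator_dotBall_eq p _), hball,
      ← ENNReal.ofReal_mul (by have := eNorm_nonneg y; positivity), ENNReal.ofReal_le_one,
      dotBall, mem_ofPred_eq, ← Real.sqrt_le_left ht0.le]
    have htp : t ^ p = d⁻¹ := by
      rw [ht, ← rpow_mul hd0.le, neg_mul, one_div_mul_cancel hp0.ne', rpow_neg_one]
    rw [← rpow_le_rpow_iff (Real.sqrt_nonneg _) ht0.le hp0, htp, ← one_div, le_div_iff₀ hd0]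
    rfl
  rw [hset, volume_dotBall ht0.le, ← hw, ← ballVol_sq_mul _ hp0, ← rpow_natCast t, ← hN, ← hw,
    ← hc]
  refine ENNReal.ofReal_le_ofReal (le_of_eq ?_)
  rw [ht, ← rpow_mul hd0.le, hd, mul_rpow (by positivity) hc0.le, hr, ← rpow_mul (by positivity),
    ← rpow_mul (by positivity), div_rpow hm.le hw0.le, div_rpow hw0.le hc0.le,
    show -(1 / p) * N = -(N / p) by ring,
    show 1 / N * ((N + p) * -(N / p)) = -(N + p) / p by field_simp, rpow_neg hc0.le,
    show -(N + p) / p = -(N / p) - 1 by field_simp; ring, rpow_sub hw0, rpow_neg hw0.le, rpow_one]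
  field_simp

end Constants

section Sphere

variable {n : ℕ} {p : ℝ}

/-- The `p`-th absolute moment of `f` in the direction `y`. -/
noncomputable def absMoment (p : ℝ) (f : EuclideanSpace ℝ (Fin n) → ℝ)
    (y : EuclideanSpace ℝ (Fin n)) : ℝ :=
  ∫ x, f x * |⟪x, y⟫| ^ p

variable {f : EuclideanSpace ℝ (Fin n) → ℝ}

lemma continuous_mul_abs_inner_rpow (hp : 0 ≤ p) (hf : Continuous f) :
    Continuous fun q : EuclideanSpace ℝ (Fin n) × EuclideanSpace ℝ (Fin n) =>
      f q.2 * |⟪q.2, q.1⟫| ^ p :=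
  (hf.comp continuous_snd).mul
    ((continuous_snd.inner continuous_fst).abs.rpow_const fun _ => .inr hp)

lemma continuous_absMoment (hp : 0 ≤ p) (hf : Continuous f) (hs : HasCompactSupport f) :
    Continuous (absMoment p f) := by
  have h := continuous_parametric_integral_of_continuous (μ := volume)
    (f := fun y x : EuclideanSpace ℝ (Fin n) => f x * |⟪x, y⟫| ^ p)
    (continuous_mul_abs_inner_rpow hp hf) hs.isCompact
  refine h.congr fun y => setIntegral_eq_integral_of_forall_compl_eq_zero fun x hx => ?_
  rw [image_eq_zero_of_notMem_tsupport hx, zero_mul]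

lemma absMoment_smul {r : ℝ} (hr : 0 ≤ r) (y : EuclideanSpace ℝ (Fin n)) :
    absMoment p f (r • y) = r ^ p * absMoment p f y := by
  rw [absMoment, absMoment, ← integral_const_mul]
  congr 1 with x
  rw [inner_smul_right, abs_mul, mul_rpow (abs_nonneg _) (abs_nonneg _), abs_of_nonneg hr]
  ring

lemma integrable_mul_abs_inner_rpow (hp : 0 ≤ p) (hf : Continuous f) (hs : HasCompactSupport f)
    (y : EuclideanSpace ℝ (Fin n)) : Integrable fun x => f x * |⟪x, y⟫| ^ p :=
  ((continuous_mul_abs_inner_rpow hp hf).comp (.prodMk_right y)).integrable_of_hasCompactSupport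
    hs.mul_right

lemma absMoment_pos (hp : 0 ≤ p) (hf : Continuous f) (h0 : ∀ x, 0 ≤ f x)
    (hs : HasCompactSupport f) (hne : f ≠ 0) {y : EuclideanSpace ℝ (Fin n)} (hy : y ≠ 0) :
    0 < absMoment p f y := by
  obtain ⟨x₀, hx₀⟩ := Function.ne_iff.1 hne
  obtain ⟨x, hx, hxy⟩ : ∃ x, f x ≠ 0 ∧ ⟪x, y⟫ ≠ 0 := by
    by_cases h : ⟪x₀, y⟫ = 0
    · have hc : ContinuousAt (fun t : ℝ => f (x₀ + t • y)) 0 := by fun_prop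
      have h1 := (hc.eventually_ne (by simpa using hx₀ : f (x₀ + (0 : ℝ) • y) ≠ 0)).filter_mono
        (nhdsWithin_le_nhds (s := {0}ᶜ))
      obtain ⟨t, ht, ht0⟩ := (h1.and self_mem_nhdsWithin).exists
      refine ⟨x₀ + t • y, ht, ?_⟩
      rw [inner_add_left, h, zero_add, real_inner_smul_left]
      exact mul_ne_zero ht0 (inner_self_ne_zero.2 hy)
    · exact ⟨x₀, hx₀, h⟩
  refine Continuous.integral_pos_of_hasCompactSupport_nonneg_nonzero
    ((continuous_mul_abs_inner_rpow hp hf).comp (.prodMk_right y)) hs.mul_right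
    (fun x => mul_nonneg (h0 x) (by positivity)) (x := x) ?_
  have := abs_pos.2 hxy
  exact mul_ne_zero hx (by positivity)

lemma ofReal_absMoment (hp : 0 ≤ p) (hf : Continuous f) (h0 : ∀ x, 0 ≤ f x)
    (hs : HasCompactSupport f) (y : Fin n → ℝ) :
    ENNReal.ofReal (absMoment p f (WithLp.toLp 2 y)) =
      Phi p (fun x => ENNReal.ofReal (f (WithLp.toLp 2 x))) y := by
  rw [absMoment, ofReal_integral_eq_lintegral_ofReal (integrable_mul_abs_inner_rpow hp hf hs _)
    (.of_forall fun x => mul_nonneg (h0 x) (by positivity)),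
    ← (PiLp.volume_preserving_toLp (Fin n)).lintegral_comp_emb
      (MeasurableEquiv.toLp 2 (Fin n → ℝ)).measurableEmbedding, Phi]
  refine lintegral_congr fun x => ?_
  rw [ENNReal.ofReal_mul (h0 _), EuclideanSpace.inner_toLp_toLp, dotProduct_comm]
  rfl

/-- Polar coordinates: the volume of the sublevel set of a homogeneous function. -/
lemma volume_lt_one_eq_lintegral_sphere (hp : 0 < p) {ψ : EuclideanSpace ℝ (Fin (n + 1)) → ℝ}
    (hψ : Continuous ψ) (hpos : ∀ x, x ≠ 0 → 0 < ψ x)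
    (hhom : ∀ (r : ℝ) x, 0 ≤ r → ψ (r • x) = r ^ p * ψ x) :
    volume {y | ψ y < 1} = ∫⁻ ξ : Metric.sphere (0 : EuclideanSpace ℝ (Fin (n + 1))) 1,
      ENNReal.ofReal (ψ ξ ^ (-((n + 1 : ℕ) : ℝ) / p) / ((n + 1 : ℕ) : ℝ)) ∂volume.toSphere := by
  have hmp := (volume :
    Measure (EuclideanSpace ℝ (Fin (n + 1)))).measurePreserving_homeomorphUnitSphereProd
  have h1 : volume {y | ψ y < 1} = (volume.comap (Subtype.val :
      ({0}ᶜ : Set (EuclideanSpace ℝ (Fin (n + 1)))) → _)) (Subtype.val ⁻¹' {y | ψ y < 1}) := by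
    rw [comap_subtype_coe_apply (measurableSet_singleton _).compl, Subtype.image_preimage_coe,
      inter_comm, ← sdiff_eq, measure_sdiff_null (measure_singleton _)]
  have h2 : (Subtype.val ⁻¹' {y | ψ y < 1} : Set ({0}ᶜ : Set (EuclideanSpace ℝ (Fin (n + 1))))) =
      homeomorphUnitSphereProd _ ⁻¹' {q | (q.2 : ℝ) ^ p * ψ q.1 < 1} := by
    ext y
    have hy := norm_pos_iff.2 y.2
    simp only [mem_preimage, mem_ofPred_eq, homeomorphUnitSphereProd_apply_fst_coe,
      homeomorphUnitSphereProd_apply_snd_coe]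
    rw [← hhom _ _ hy.le, smul_smul, mul_inv_cancel₀ hy.ne', one_smul]
  set T := {q : Metric.sphere (0 : EuclideanSpace ℝ (Fin (n + 1))) 1 × Ioi (0 : ℝ) |
    (q.2 : ℝ) ^ p * ψ q.1 < 1}
  have hmeas : MeasurableSet T := by
    refine (isOpen_lt ?_ continuous_const).measurableSet
    exact ((continuous_subtype_val.comp continuous_snd).rpow_const fun _ => .inr hp.le).mul
      (hψ.comp (continuous_subtype_val.comp continuous_fst))
  rw [h1, h2, hmp.measure_preimage hmeas.nullMeasurableSet, Measure.prod_apply hmeas]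
  refine lintegral_congr fun ξ => ?_
  have hξ : 0 < ψ ξ := hpos _ (Metric.ne_of_mem_sphere ξ.2 one_ne_zero)
  set t : ℝ := ψ ξ ^ (-(1 / p)) with ht
  have ht0 : 0 < t := by positivity
  have htp : t ^ p = (ψ ξ)⁻¹ := by
    rw [ht, ← rpow_mul hξ.le, neg_mul, one_div_mul_cancel hp.ne', rpow_neg_one]
  have h3 : Prod.mk ξ ⁻¹' T = Iio (⟨t, ht0⟩ : Ioi (0 : ℝ)) := by
    ext r
    have hr : (0 : ℝ) < r := r.2
    rw [mem_Iio, ← Subtype.coe_lt_coe, ← rpow_lt_rpow_iff hr.le ht0.le hp, htp, ← one_div,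
      lt_div_iff₀ hξ]
    rfl
  rw [h3, finrank_euclideanSpace_fin, Nat.add_sub_cancel, Measure.volumeIoiPow_apply_Iio]
  congr 1
  simp only [ht]
  rw [← rpow_natCast, ← rpow_mul hξ.le]
  push_cast
  ring_nf

lemma lintegral_ofReal_comp_toLp (hf : Continuous f) (h0 : ∀ x, 0 ≤ f x)
    (hs : HasCompactSupport f) :
    ∫⁻ x, ENNReal.ofReal (f (WithLp.toLp 2 x)) = ENNReal.ofReal (∫ x, f x) := by
  rw [ofReal_integral_eq_lintegral_ofReal (hf.integrable_of_hasCompactSupport hs) (.of_forall h0),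
    ← (PiLp.volume_preserving_toLp (Fin n)).lintegral_comp_emb
      (MeasurableEquiv.toLp 2 (Fin n → ℝ)).measurableEmbedding]

lemma exists_ballSupp (hs : HasCompactSupport f) :
    ∃ R, BallSupp R fun x => ENNReal.ofReal (f (WithLp.toLp 2 x)) := by
  obtain ⟨r, hr⟩ := hs.isCompact.isBounded.subset_closedBall 0
  refine ⟨r ^ 2, fun x hx => ?_⟩
  have hfx : f (WithLp.toLp 2 x) ≠ 0 := fun h => hx (by simp [h])
  have := mem_closedBall_zero_iff.1 (hr (subset_tsupport f hfx))
  rw [← norm_toLp_sq]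
  exact pow_le_pow_left₀ (norm_nonneg _) this 2

lemma volume_absMoment_lt_one_le {f : EuclideanSpace ℝ (Fin (n + 1)) → ℝ} (hp : 0 ≤ p)
    (hf : Continuous f) (h0 : ∀ x, 0 ≤ f x) (hs : HasCompactSupport f) :
    volume {y | absMoment p f y < 1} ≤
      volume {y | Phi p (fun x => ENNReal.ofReal (f (WithLp.toLp 2 x))) y ≤ 1} := by
  rw [← (PiLp.volume_preserving_toLp _).measure_preimage
    (isOpen_lt (continuous_absMoment hp hf hs) continuous_const).measurableSet.nullMeasurableSet]
  refine measure_mono fun y hy => ?_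
  rw [mem_ofPred_eq, ← ofReal_absMoment hp hf h0 hs, ENNReal.ofReal_le_one]
  exact le_of_lt hy

/-- The sharp constant in the integral form of the inequality. -/
noncomputable def sphereConst (n : ℕ) (p : ℝ) : ℝ := n * (Rnp n p * 2 ^ (-(n : ℝ) / p))

lemma continuous_absMoment_rpow_sphere (q : ℝ) (hp : 0 ≤ p) (hf : Continuous f)
    (h0 : ∀ x, 0 ≤ f x) (hs : HasCompactSupport f) (hne : f ≠ 0) :
    Continuous fun ξ : Metric.sphere (0 : EuclideanSpace ℝ (Fin n)) 1 => absMoment p f ξ ^ q :=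
  ((continuous_absMoment hp hf hs).comp continuous_subtype_val).rpow_const fun ξ =>
    .inl (absMoment_pos hp hf h0 hs hne (Metric.ne_of_mem_sphere ξ.2 one_ne_zero)).ne'

lemma absMoment_nonneg (h0 : ∀ x, 0 ≤ f x) (y : EuclideanSpace ℝ (Fin n)) :
    0 ≤ absMoment p f y :=
  integral_nonneg fun x => mul_nonneg (h0 x) (by positivity)

lemma integrable_absMoment_rpow_sphere (q : ℝ) (hp : 0 ≤ p) (hf : Continuous f)
    (h0 : ∀ x, 0 ≤ f x) (hs : HasCompactSupport f) (hne : f ≠ 0) :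
    Integrable (fun ξ : Metric.sphere (0 : EuclideanSpace ℝ (Fin n)) 1 => absMoment p f ξ ^ q)
      volume.toSphere :=
  (continuous_absMoment_rpow_sphere q hp hf h0 hs hne).integrable_of_hasCompactSupport
    (.of_compactSpace _)

lemma integral_pos_of_continuous (hf : Continuous f) (h0 : ∀ x, 0 ≤ f x)
    (hs : HasCompactSupport f) (hne : f ≠ 0) : 0 < ∫ x, f x := by
  obtain ⟨x, hx⟩ := Function.ne_iff.1 hne
  exact hf.integral_pos_of_hasCompactSupport_nonneg_nonzero hs h0 hx

lemma integral_sphere_le_of_le_one {f : EuclideanSpace ℝ (Fin (n + 1)) → ℝ} (hp : 1 ≤ p)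
    (hf : Continuous f) (h0 : ∀ x, 0 ≤ f x) (hs : HasCompactSupport f) (hne : f ≠ 0)
    (h1 : ∀ x, f x ≤ 1) :
    ∫ ξ : Metric.sphere (0 : EuclideanSpace ℝ (Fin (n + 1))) 1,
        absMoment p f ξ ^ (-((n + 1 : ℕ) : ℝ) / p) ∂volume.toSphere ≤
      sphereConst (n + 1) p * (∫ x, f x) ^ (-(((n + 1 : ℕ) : ℝ) + p) / p) := by
  have hp0 : 0 < p := by linarith
  have hm := integral_pos_of_continuous hf h0 hs hne
  obtain ⟨R, hR⟩ := exists_ballSupp hs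
  have hmeas : Measurable fun x : Fin (n + 1) → ℝ => ENNReal.ofReal (f (WithLp.toLp 2 x)) :=
    (hf.measurable.comp (PiLp.volume_preserving_toLp _).measurable).ennreal_ofReal
  have h := (volume_absMoment_lt_one_le hp0.le hf h0 hs).trans (volume_Phi_le_one_le hp hmeas
    (fun x => by simpa using h1 _) hR hm (lintegral_ofReal_comp_toLp hf h0 hs))
  have hint := (integrable_absMoment_rpow_sphere (-((n + 1 : ℕ) : ℝ) / p) hp0.le hf h0 hs
    hne).div_const ((n + 1 : ℕ) : ℝ)
  rw [volume_lt_one_eq_lintegral_sphere hp0 (continuous_absMoment hp0.le hf hs)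
    (fun x hx => absMoment_pos hp0.le hf h0 hs hne hx) (fun r x hr => absMoment_smul hr x),
    ← ofReal_integral_eq_lintegral_ofReal hint
      (.of_forall fun ξ => div_nonneg (rpow_nonneg (absMoment_nonneg h0 _) _) (by positivity)),
    integral_div, ENNReal.ofReal_le_ofReal_iff, div_le_iff₀ (by positivity)] at h
  · rw [sphereConst]
    exact h.trans_eq (by ring)
  · have : 0 < Rnp (n + 1) p * 2 ^ (-((n + 1 : ℕ) : ℝ) / p) := by
      rw [← ballVol_sq_mul _ hp0]
      have := ballVol_pos (n + 1)
      have := ballMoment_pos (n + 1) hp0.le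
      positivity
    positivity

lemma absMoment_const_mul (b : ℝ) (y : EuclideanSpace ℝ (Fin n)) :
    absMoment p (fun x => b * f x) y = b * absMoment p f y := by
  simp_rw [absMoment, mul_assoc, integral_const_mul]

theorem integral_sphere_le {f : EuclideanSpace ℝ (Fin (n + 1)) → ℝ} (hp : 1 ≤ p)
    (hf : Continuous f) (h0 : ∀ x, 0 ≤ f x) (hs : HasCompactSupport f) (hne : f ≠ 0)
    {b : ℝ} (hb0 : 0 < b) (hb : ∀ x, f x ≤ b) :
    ∫ ξ : Metric.sphere (0 : EuclideanSpace ℝ (Fin (n + 1))) 1,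
        absMoment p f ξ ^ (-((n + 1 : ℕ) : ℝ) / p) ∂volume.toSphere ≤
      sphereConst (n + 1) p * b * (∫ x, f x) ^ (-(((n + 1 : ℕ) : ℝ) + p) / p) := by
  have hp0 : 0 < p := by linarith
  have hm := integral_pos_of_continuous hf h0 hs hne
  have h := integral_sphere_le_of_le_one (f := fun x => b⁻¹ * f x) hp (by fun_prop)
    (fun x => mul_nonneg (by positivity) (h0 x)) hs.mul_left
    (fun h => hne (funext fun x => by
      simpa [hb0.ne'] using congrFun h x)) (fun x => by
      rw [inv_mul_le_iff₀ hb0, mul_one]; exact hb x)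
  simp_rw [absMoment_const_mul, mul_rpow (inv_nonneg.2 hb0.le) (absMoment_nonneg h0 _),
    integral_const_mul] at h
  rw [mul_rpow (inv_nonneg.2 hb0.le) hm.le, inv_rpow hb0.le, inv_rpow hb0.le,
    show -(((n + 1 : ℕ) : ℝ) + p) / p = -((n + 1 : ℕ) : ℝ) / p - 1 by field_simp; ring,
    rpow_sub_one hb0.ne', inv_mul_le_iff₀ (by positivity)] at h
  refine h.trans_eq ?_
  rw [show -(((n + 1 : ℕ) : ℝ) + p) / p = -((n + 1 : ℕ) : ℝ) / p - 1 by field_simp; ring]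
  have : b ^ (-((n + 1 : ℕ) : ℝ) / p) ≠ 0 := by positivity
  field_simp

end Sphere

section Strict

variable {n : ℕ} {p : ℝ}

lemma sphereConst_pos (hp : 0 < p) : 0 < sphereConst (n + 1) p := by
  rw [sphereConst, ← ballVol_sq_mul _ hp]
  have := ballVol_pos (n + 1)
  have := ballMoment_pos (n + 1) hp.le
  positivity

lemma add_rpow_neg_le {u v a c k l q : ℝ} (hu : 0 < u) (hv : 0 < v) (ha : 0 < a) (hc : 0 < c)
    (hac : a + c = 1) (hk : 0 < k) (hl : 0 < l) (hq : 0 ≤ q) :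
    (u + v) ^ (-q) ≤ a ^ (q * a) * c ^ (q * c) * (k ^ a * l ^ c) *
      (a * (u ^ (-q) / k) + c * (v ^ (-q) / l)) := by
  have h1 : (u / a) ^ a * (v / c) ^ c ≤ u + v := by
    refine (geom_mean_le_arith_mean2_weighted ha.le hc.le (by positivity) (by positivity)
      hac).trans_eq ?_
    field_simp
  have h2 := geom_mean_le_arith_mean2_weighted ha.le hc.le
    (p₁ := u ^ (-q) / k) (p₂ := v ^ (-q) / l) (by positivity) (by positivity) hac
  refine (rpow_le_rpow_of_nonpos (by positivity) h1 (by linarith)).trans ?_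
  refine le_trans (le_of_eq ?_) (mul_le_mul_of_nonneg_left h2 (by positivity))
  rw [mul_rpow (by positivity) (by positivity), ← rpow_mul (by positivity),
    ← rpow_mul (by positivity), div_rpow hu.le ha.le, div_rpow hv.le hc.le,
    div_rpow (by positivity) hk.le, div_rpow (by positivity) hl.le, ← rpow_mul hu.le,
    ← rpow_mul hv.le, show a * -q = -(q * a) by ring, show c * -q = -(q * c) by ring,
    show -q * a = -(q * a) by ring, show -q * c = -(q * c) by ring,
    rpow_neg ha.le, rpow_neg hc.le]
  field_simp

lemma rpow_neg_self_mul_lt_two {a c : ℝ} (ha : 0 < a) (hc : 0 < c) (hac : a + c = 1)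
    (hne : a ≠ c) : a ^ (-a) * c ^ (-c) < 2 := by
  obtain rfl : c = 1 - a := by linarith
  have h : binEntropy a < log 2 := binEntropy_lt_log_two.2 fun h => hne (by rw [h]; norm_num)
  rw [← exp_lt_exp, exp_log two_pos] at h
  refine lt_of_eq_of_lt ?_ h
  rw [binEntropy, exp_add, rpow_def_of_pos ha, rpow_def_of_pos hc, log_inv, log_inv]
  ring_nf

lemma rpow_mul_mul_rpow_neg {a d m q : ℝ} (ha : 0 < a) (hd : 0 < d) (hm : 0 < m) :
    a ^ (q * a) * (d * (a * m) ^ (-(q + 1))) ^ a = (d * m ^ (-(q + 1))) ^ a * a ^ (-a) := by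
  rw [mul_rpow ha.le hm.le, mul_left_comm d, mul_rpow (by positivity) (by positivity),
    ← rpow_mul ha.le, ← mul_assoc, ← rpow_add ha, mul_comm]
  ring_nf

lemma exists_eq_of_hasCompactSupport {f : EuclideanSpace ℝ (Fin (n + 1)) → ℝ}
    (hf : Continuous f) (hs : HasCompactSupport f) {x₁ : EuclideanSpace ℝ (Fin (n + 1))} {c : ℝ}
    (hc : 0 ≤ c) (hx : c ≤ f x₁) : ∃ x, f x = c := by
  obtain ⟨z, hz⟩ := (ne_univ_iff_exists_notMem _).1 hs.isCompact.ne_univ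
  exact mem_range_of_exists_le_of_exists_ge hf
    ⟨z, by rwa [image_eq_zero_of_notMem_tsupport hz]⟩ ⟨x₁, hx⟩

lemma absMoment_add {f g : EuclideanSpace ℝ (Fin n) → ℝ} (hp : 0 ≤ p) (hf : Continuous f)
    (hfs : HasCompactSupport f) (hg : Continuous g) (hgs : HasCompactSupport g)
    (y : EuclideanSpace ℝ (Fin n)) :
    absMoment p (f + g) y = absMoment p f y + absMoment p g y := by
  rw [absMoment, absMoment, absMoment, ← integral_add (integrable_mul_abs_inner_rpow hp hf hfs y)
    (integrable_mul_abs_inner_rpow hp hg hgs y)]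
  simp_rw [Pi.add_apply, add_mul]

variable {f g : EuclideanSpace ℝ (Fin (n + 1)) → ℝ}

/-- Two functions bounded by `b` with different masses have a sum for which the inequality with
the bound `2 * b` is strict. -/
lemma integral_sphere_add_lt (hp : 1 ≤ p) (hf : Continuous f) (hf0 : ∀ x, 0 ≤ f x)
    (hfs : HasCompactSupport f) (hfne : f ≠ 0) (hg : Continuous g) (hg0 : ∀ x, 0 ≤ g x)
    (hgs : HasCompactSupport g) (hgne : g ≠ 0) {b : ℝ} (hb : 0 < b) (hfb : ∀ x, f x ≤ b)
    (hgb : ∀ x, g x ≤ b) (hne : ∫ x, f x ≠ ∫ x, g x) :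
    ∫ ξ : Metric.sphere (0 : EuclideanSpace ℝ (Fin (n + 1))) 1,
        absMoment p (f + g) ξ ^ (-((n + 1 : ℕ) : ℝ) / p) ∂volume.toSphere <
      sphereConst (n + 1) p * (2 * b) *
        (∫ x, f x + g x) ^ (-(((n + 1 : ℕ) : ℝ) + p) / p) := by
  have hp0 : 0 < p := by linarith
  have hA := sphereConst_pos (n := n) hp0
  have hJf := integral_sphere_le hp hf hf0 hfs hfne hb hfb
  have hJg := integral_sphere_le hp hg hg0 hgs hgne hb hgb
  have hif := integrable_absMoment_rpow_sphere (-((n + 1 : ℕ) : ℝ) / p) hp0.le hf hf0 hfs hfne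
  have hig := integrable_absMoment_rpow_sphere (-((n + 1 : ℕ) : ℝ) / p) hp0.le hg hg0 hgs hgne
  have hmf := integral_pos_of_continuous hf hf0 hfs hfne
  have hmg := integral_pos_of_continuous hg hg0 hgs hgne
  rw [integral_add (hf.integrable_of_hasCompactSupport hfs)
    (hg.integrable_of_hasCompactSupport hgs)]
  set q : ℝ := ((n + 1 : ℕ) : ℝ) / p with hq
  have hq0 : 0 < q := by positivity
  have hqe : -((n + 1 : ℕ) : ℝ) / p = -q := neg_div _ _
  have hqe' : -(((n + 1 : ℕ) : ℝ) + p) / p = -(q + 1) := by rw [hq]; field_simp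
  rw [hqe] at hif hig ⊢
  rw [hqe, hqe'] at hJf hJg
  rw [hqe']
  set s := ∫ x, f x with hs
  set t := ∫ x, g x with ht
  set k := sphereConst (n + 1) p * b * s ^ (-(q + 1)) with hk
  set l := sphereConst (n + 1) p * b * t ^ (-(q + 1)) with hl
  set m := s + t with hm
  have hm0 : 0 < m := by positivity
  set a := s / m with ha
  set c := t / m with hc
  have ha0 : 0 < a := by positivity
  have hc0 : 0 < c := by positivity
  have hac : a + c = 1 := by rw [ha, hc, ← add_div, div_self hm0.ne']
  have hk0 : 0 < k := by positivity
  have hl0 : 0 < l := by positivity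
  have hpt : ∀ ξ : Metric.sphere (0 : EuclideanSpace ℝ (Fin (n + 1))) 1,
      absMoment p (f + g) ξ ^ (-q) ≤ a ^ (q * a) * c ^ (q * c) * (k ^ a * l ^ c) *
        (a * (absMoment p f ξ ^ (-q) / k) + c * (absMoment p g ξ ^ (-q) / l)) := fun ξ => by
    have hξ := Metric.ne_of_mem_sphere ξ.2 one_ne_zero
    rw [absMoment_add hp0.le hf hfs hg hgs]
    exact add_rpow_neg_le (absMoment_pos hp0.le hf hf0 hfs hfne hξ)
      (absMoment_pos hp0.le hg hg0 hgs hgne hξ) ha0 hc0 hac hk0 hl0 hq0.le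
  have hle := integral_mono_of_nonneg (.of_forall fun ξ => rpow_nonneg (absMoment_nonneg
    (fun x => add_nonneg (hf0 x) (hg0 x)) _) _)
    ((((hif.div_const k).const_mul a).add ((hig.div_const l).const_mul c)).const_mul
      (a ^ (q * a) * c ^ (q * c) * (k ^ a * l ^ c))) (.of_forall hpt)
  refine hle.trans_lt ?_
  rw [integral_const_mul, integral_add' ((hif.div_const k).const_mul a)
    ((hig.div_const l).const_mul c), integral_const_mul, integral_const_mul, integral_div,
    integral_div]
  have h1 : a * ((∫ ξ : Metric.sphere (0 : EuclideanSpace ℝ (Fin (n + 1))) 1,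
      absMoment p f ξ ^ (-q) ∂volume.toSphere) / k) +
      c * ((∫ ξ : Metric.sphere (0 : EuclideanSpace ℝ (Fin (n + 1))) 1,
      absMoment p g ξ ^ (-q) ∂volume.toSphere) / l) ≤ 1 := by
    refine le_of_le_of_eq ?_ hac
    exact add_le_add (mul_le_of_le_one_right ha0.le (div_le_one_of_le₀ hJf hk0.le))
      (mul_le_of_le_one_right hc0.le (div_le_one_of_le₀ hJg hl0.le))
  refine (mul_le_of_le_one_right (by positivity) h1).trans_lt ?_
  have hsa : s = a * m := by rw [ha]; field_simp
  have htc : t = c * m := by rw [hc]; field_simp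
  have hD : 0 < sphereConst (n + 1) p * b := by positivity
  have hka : a ^ (q * a) * k ^ a =
      (sphereConst (n + 1) p * b * m ^ (-(q + 1))) ^ a * a ^ (-a) := by
    rw [hk, hsa, rpow_mul_mul_rpow_neg ha0 hD hm0]
  have hlc : c ^ (q * c) * l ^ c =
      (sphereConst (n + 1) p * b * m ^ (-(q + 1))) ^ c * c ^ (-c) := by
    rw [hl, htc, rpow_mul_mul_rpow_neg hc0 hD hm0]
  calc a ^ (q * a) * c ^ (q * c) * (k ^ a * l ^ c)
      = a ^ (q * a) * k ^ a * (c ^ (q * c) * l ^ c) := by ring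
    _ = sphereConst (n + 1) p * b * m ^ (-(q + 1)) * (a ^ (-a) * c ^ (-c)) := by
        rw [hka, hlc, mul_mul_mul_comm, ← rpow_add (by positivity), hac, rpow_one]
    _ < sphereConst (n + 1) p * b * m ^ (-(q + 1)) * 2 := by
        refine mul_lt_mul_of_pos_left (rpow_neg_self_mul_lt_two ha0 hc0 hac fun h => hne ?_)
          (by positivity)
        rw [hsa, htc, h]
    _ = _ := by ring

theorem integral_sphere_lt (hp : 1 ≤ p) (hf : Continuous f) (hf0 : ∀ x, 0 ≤ f x)
    (hfs : HasCompactSupport f) {x₁ : EuclideanSpace ℝ (Fin (n + 1))} (hx₁ : 0 < f x₁)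
    (hmax : ∀ x, f x ≤ f x₁) :
    ∫ ξ : Metric.sphere (0 : EuclideanSpace ℝ (Fin (n + 1))) 1,
        absMoment p f ξ ^ (-((n + 1 : ℕ) : ℝ) / p) ∂volume.toSphere <
      sphereConst (n + 1) p * f x₁ * (∫ x, f x) ^ (-(((n + 1 : ℕ) : ℝ) + p) / p) := by
  set b := f x₁ / 2 with hb
  have hb0 : 0 < b := by positivity
  have hb2 : f x₁ = 2 * b := by rw [hb]; ring
  set u : EuclideanSpace ℝ (Fin (n + 1)) → ℝ := fun x => min (f x) b with hu
  set v : EuclideanSpace ℝ (Fin (n + 1)) → ℝ := fun x => max (f x - b) 0 with hv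
  have huv : f = u + v := by
    ext x
    simp only [hu, hv, Pi.add_apply]
    rcases le_total (f x) b with h | h
    · rw [min_eq_left h, max_eq_right (by linarith), add_zero]
    · rw [min_eq_right h, max_eq_left (by linarith)]; ring
  have huc : Continuous u := hf.min continuous_const
  have hvc : Continuous v := (hf.sub continuous_const).max continuous_const
  have hus : HasCompactSupport u := hfs.mono fun x hx h => hx (by simp [hu, h, hb0.le])
  have hvs : HasCompactSupport v := hfs.mono fun x hx h => hx (by simp [hv, h, hb0.le])
  have hu1 : u x₁ = b := by simp only [hu]; exact min_eq_right (by linarith)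
  have hv1 : v x₁ = b := by simp only [hv]; rw [max_eq_left (by linarith)]; linarith
  have hune : u ≠ 0 := fun h => hb0.ne' (by rw [← hu1, h]; rfl)
  have hvne : v ≠ 0 := fun h => hb0.ne' (by rw [← hv1, h]; rfl)
  have hmass : ∫ x, u x ≠ ∫ x, v x := by
    obtain ⟨z, hz⟩ := exists_eq_of_hasCompactSupport hf hfs hb0.le
      (show b ≤ f x₁ by linarith)
    have hle : ∀ x, v x ≤ u x := fun x => by
      have := hmax x
      exact max_le (le_min (by linarith) (by linarith)) (le_min (hf0 x) hb0.le)
    have hpos : 0 < ∫ x, u x - v x :=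
      (huc.sub hvc).integral_pos_of_hasCompactSupport_nonneg_nonzero (hus.sub hvs)
        (fun x => sub_nonneg.2 (hle x)) (x := z) (by simp [hu, hv, hz, hb0.ne'])
    rw [integral_sub (huc.integrable_of_hasCompactSupport hus)
      (hvc.integrable_of_hasCompactSupport hvs)] at hpos
    linarith
  have h := integral_sphere_add_lt hp huc (fun x => le_min (hf0 x) hb0.le) hus hune hvc
    (fun x => le_max_right _ _) hvs hvne hb0 (fun x => min_le_right _ _)
    (fun x => max_le (by have := hmax x; linarith) hb0.le) hmass
  rw [← huv, ← hb2] at h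
  rwa [show (fun x => u x + v x) = f from huv.symm] at h

theorem integral_rpow_lt (hp : 1 ≤ p) (hf : Continuous f) (hf0 : ∀ x, 0 ≤ f x)
    (hfs : HasCompactSupport f) {x₁ : EuclideanSpace ℝ (Fin (n + 1))} (hx₁ : 0 < f x₁)
    (hmax : ∀ x, f x ≤ f x₁) :
    (∫ x, f x) ^ (((n + 1 : ℕ) : ℝ) + p) <
      2 ^ (-((n + 1 : ℕ) : ℝ)) * ((n + 1 : ℕ) : ℝ) ^ p * Rnp (n + 1) p ^ p * f x₁ ^ p *
        (∫ ξ : Metric.sphere (0 : EuclideanSpace ℝ (Fin (n + 1))) 1,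
          absMoment p f ξ ^ (-((n + 1 : ℕ) : ℝ) / p) ∂volume.toSphere) ^ (-p) := by
  have hp0 : 0 < p := by linarith
  have hne : f ≠ 0 := fun h => hx₁.ne' (by rw [h]; rfl)
  have h := integral_sphere_lt hp hf hf0 hfs hx₁ hmax
  have hm := integral_pos_of_continuous hf hf0 hfs hne
  set J := ∫ ξ : Metric.sphere (0 : EuclideanSpace ℝ (Fin (n + 1))) 1,
    absMoment p f ξ ^ (-((n + 1 : ℕ) : ℝ) / p) ∂volume.toSphere
  have hJ : 0 < J := by
    obtain ⟨ξ, hξ⟩ := NormedSpace.sphere_nonempty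
      (x := (0 : EuclideanSpace ℝ (Fin (n + 1)))) (r := 1).2 zero_le_one
    have := absMoment_pos hp0.le hf hf0 hfs hne (Metric.ne_of_mem_sphere hξ one_ne_zero)
    exact (continuous_absMoment_rpow_sphere _ hp0.le hf hf0 hfs
      hne).integral_pos_of_hasCompactSupport_nonneg_nonzero (.of_compactSpace _)
      (fun ξ => rpow_nonneg (absMoment_nonneg hf0 _) _) (x := ⟨ξ, hξ⟩) (by positivity)
  have hR : 0 < Rnp (n + 1) p := by
    have := sphereConst_pos (n := n) hp0
    rw [sphereConst] at this
    exact pos_of_mul_pos_left (pos_of_mul_pos_right this (by positivity)) (by positivity)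
  set m := ∫ x, f x
  have h2 := rpow_lt_rpow hJ.le h hp0
  rw [sphereConst, mul_rpow (by positivity) (by positivity),
    mul_rpow (by positivity) (by positivity), mul_rpow (by positivity) (by positivity),
    mul_rpow (by positivity) (by positivity), ← rpow_mul two_pos.le, ← rpow_mul hm.le,
    div_mul_cancel₀ _ hp0.ne', div_mul_cancel₀ _ hp0.ne', rpow_neg hm.le, ← div_eq_mul_inv,
    lt_div_iff₀ (by positivity)] at h2
  rw [rpow_neg hJ.le, ← div_eq_mul_inv, lt_div_iff₀ (by positivity)]
  linarith

end Strict

end LpSantalo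

/-- Symmetric functional `L_p` Blaschke–Santaló inequality, case `λ = ∞`, with its
equality case: `f` must be a positive multiple of the characteristic function of an
origin-centered ellipsoid. -/
theorem functional_BS_symmetric_top (n : ℕ) (hn : 2 ≤ n) (p : ℝ) (hp : 1 ≤ p)
    (f : EuclideanSpace ℝ (Fin n) → ℝ) (hf_cont : Continuous f)
    (hf_nonneg : ∀ x, 0 ≤ f x) (hf_supp : HasCompactSupport f) (hf_ne : f ≠ 0) :
    (∫ x, f x) ^ ((n : ℝ) + p) ≤
      2 ^ (-(n : ℝ)) * (n : ℝ) ^ p * Rnp n p ^ p * (⨆ x, f x) ^ p *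
        (∫ ξ : Metric.sphere (0 : EuclideanSpace ℝ (Fin n)) 1,
            (∫ x, f x * |⟪x, (ξ : EuclideanSpace ℝ (Fin n))⟫| ^ p) ^ (-(n : ℝ) / p)
          ∂((volume : Measure (EuclideanSpace ℝ (Fin n))).toSphere)) ^ (-p) ∧
    ((∫ x, f x) ^ ((n : ℝ) + p) =
      2 ^ (-(n : ℝ)) * (n : ℝ) ^ p * Rnp n p ^ p * (⨆ x, f x) ^ p *
        (∫ ξ : Metric.sphere (0 : EuclideanSpace ℝ (Fin n)) 1,
            (∫ x, f x * |⟪x, (ξ : EuclideanSpace ℝ (Fin n))⟫| ^ p) ^ (-(n : ℝ) / p)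
          ∂((volume : Measure (EuclideanSpace ℝ (Fin n))).toSphere)) ^ (-p) ↔
      ∃ a : ℝ, 0 < a ∧ ∃ B : Matrix (Fin n) (Fin n) ℝ, IsUnit B.det ∧
        ∀ x, f x = if ‖matApply B x‖ ≤ 1 then a else 0) := by
  obtain ⟨n, rfl⟩ : ∃ k, n = k + 1 := ⟨n - 1, by omega⟩
  obtain ⟨x₁, hmax⟩ := hf_cont.exists_forall_ge_of_hasCompactSupport hf_supp
  have hx₁ : 0 < f x₁ := by
    obtain ⟨x, hx⟩ := Function.ne_iff.1 hf_ne
    exact ((hf_nonneg x).lt_of_ne' hx).trans_le (hmax x)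
  have hsup : ⨆ x, f x = f x₁ :=
    le_antisymm (ciSup_le hmax) (le_ciSup ⟨f x₁, Set.forall_mem_range.2 hmax⟩ x₁)
  have hlt := LpSantalo.integral_rpow_lt hp hf_cont hf_nonneg hf_supp hx₁ hmax
  rw [hsup]
  refine ⟨hlt.le, fun h => absurd h hlt.ne, ?_⟩
  rintro ⟨a, ha, B, -, hB⟩
  have hval : ∀ x, f x = a ∨ f x = 0 := fun x => by
    rw [hB x]
    split_ifs <;> simp
  obtain ⟨z, hz⟩ := LpSantalo.exists_eq_of_hasCompactSupport hf_cont hf_supp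
    (half_pos hx₁).le (half_le_self hx₁.le)
  rcases hval x₁ with h | h <;> rcases hval z with h' | h' <;> linarith
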